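/- arXiv:2112.11970 — 2 statements merged into one kernel-verified Lean document; each statement's English description precedes it below -/
import Mathlib

section
/- Let G be a long theta with apexes u and v, and let x be a degree-2 vertex of G whose two neighbors also have degree 2. Then in every orientation of any subdivision G* of G as an oriented Burling graph, x is a subordinate vertex of some hole of G* (i.e., x is a global subordinate vertex). -/
namespace BurlingFormal

open SimpleGraph

/-- An orientation of a simple graph, given as a relation choosing a direction for each edge. -/
def IsOrientation {V : Type} (G : SimpleGraph V) (A : V → V → Prop) : Prop :=
  (∀ u v, A u v → G.Adj u v) ∧ (∀ u v, G.Adj u v → (A u v ↔ ¬ A v u))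

/-- A chordless cycle: a cycle such that every adjacency between its vertices is a cycle edge. -/
def IsChordlessCycle {V : Type} (G : SimpleGraph V) {v : V} (c : G.Walk v v) : Prop :=
  c.IsCycle ∧ ∀ x y, x ∈ c.support → y ∈ c.support → G.Adj x y → s(x, y) ∈ c.edges

/-- A hole: a chordless cycle of length at least 4. -/
def IsHole {V : Type} (G : SimpleGraph V) {v : V} (c : G.Walk v v) : Prop :=
  IsChordlessCycle G c ∧ 4 ≤ c.length

/-- A source of a hole w.r.t. an orientation: both its neighbours on the hole are out-neighbours. -/
def IsHoleSource {V : Type} {G : SimpleGraph V} {v : V} (A : V → V → Prop)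
    (c : G.Walk v v) (x : V) : Prop :=
  x ∈ c.support ∧ ∀ y, s(x, y) ∈ c.edges → A x y

/-- A sink of a hole w.r.t. an orientation: both its neighbours on the hole are in-neighbours. -/
def IsHoleSink {V : Type} {G : SimpleGraph V} {v : V} (A : V → V → Prop)
    (c : G.Walk v v) (x : V) : Prop :=
  x ∈ c.support ∧ ∀ y, s(x, y) ∈ c.edges → A y x

/-- An extremum of a hole: a source or a sink of it. -/
def IsHoleExtremum {V : Type} {G : SimpleGraph V} {v : V} (A : V → V → Prop)
    (c : G.Walk v v) (x : V) : Prop :=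
  IsHoleSource A c x ∨ IsHoleSink A c x

/-- The hole has exactly two sources and exactly two sinks. -/
def TwoSourcesTwoSinks {V : Type} {G : SimpleGraph V} {v : V} (A : V → V → Prop)
    (c : G.Walk v v) : Prop :=
  (∃ s₁ s₂, s₁ ≠ s₂ ∧ IsHoleSource A c s₁ ∧ IsHoleSource A c s₂ ∧
    ∀ s, IsHoleSource A c s → s = s₁ ∨ s = s₂) ∧
  (∃ t₁ t₂, t₁ ≠ t₂ ∧ IsHoleSink A c t₁ ∧ IsHoleSink A c t₂ ∧
    ∀ t, IsHoleSink A c t → t = t₁ ∨ t = t₂)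

/-- The pivot of a hole: a sink adjacent on the hole to all of its sources. -/
def IsHolePivot {V : Type} {G : SimpleGraph V} {v : V} (A : V → V → Prop)
    (c : G.Walk v v) (x : V) : Prop :=
  IsHoleSink A c x ∧ ∀ y, IsHoleSource A c y → s(x, y) ∈ c.edges

/-- A subordinate vertex of a hole: neither an antenna (source) nor the pivot. -/
def IsHoleSubordinate {V : Type} {G : SimpleGraph V} {v : V} (A : V → V → Prop)
    (c : G.Walk v v) (x : V) : Prop :=
  x ∈ c.support ∧ ¬ IsHoleSource A c x ∧ ¬ IsHolePivot A c x

/-- `S` is the vertex set of a (possibly empty) branch (downward path) starting at `u`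
in the rooted tree given by the parent function. -/
def IsBranchFrom {V : Type} (parent : V → V) (u : V) (S : Set V) : Prop :=
  S = ∅ ∨ (u ∈ S ∧ (∀ w ∈ S, w ≠ u → parent w ∈ S ∧ parent w ≠ w) ∧
    ∀ w ∈ S, ∀ w' ∈ S, w ≠ u → w' ≠ u → parent w = parent w' → w = w')

/-- A Burling tree: a rooted tree (given by a parent function) together with a last-born
function and a choose function assigning to each non-last-born non-root vertex the vertex set
of a branch starting at the last-born of its parent. -/
structure BurlingTree (V : Type) where
  parent : V → V
  root : V
  parent_root : parent root = root
  reach : ∀ v, ∃ n, parent^[n] v = root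
  lastBorn : V → V
  lastBorn_child : ∀ v, (∃ u, u ≠ v ∧ parent u = v) → parent (lastBorn v) = v ∧ lastBorn v ≠ v
  choosePath : V → Set V
  choosePath_empty : ∀ v, v = root ∨ v = lastBorn (parent v) → choosePath v = ∅
  choosePath_branch : ∀ v, v ≠ root → v ≠ lastBorn (parent v) →
    IsBranchFrom parent (lastBorn (parent v)) (choosePath v)

/-- The arcs of the oriented graph fully derived from a Burling tree. -/
def BurlingTree.Arc {V : Type} (T : BurlingTree V) (u v : V) : Prop :=
  v ∈ T.choosePath u

/-- `A` orients `G` so that `G` with this orientation is an oriented graph derived from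
some Burling tree (an oriented Burling graph). -/
def IsOrientedBurling {W : Type} (G : SimpleGraph W) (A : W → W → Prop) : Prop :=
  IsOrientation G A ∧
    ∃ (V : Type) (T : BurlingTree V) (f : W ↪ V), ∀ u v, A u v ↔ T.Arc (f u) (f v)

/-- A Burling graph (equivalently, a derived graph): the underlying graph of an oriented
graph derived from a Burling tree. -/
def IsBurlingGraph {W : Type} (G : SimpleGraph W) : Prop :=
  ∃ A, IsOrientedBurling G A

/-- A global subordinate vertex of a Burling graph: subordinate in some hole, for every
orientation of the graph as an oriented Burling graph. -/
def IsGlobalSubordinate {W : Type} (G : SimpleGraph W) (x : W) : Prop :=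
  ∀ A, IsOrientedBurling G A →
    ∃ (v : W) (c : G.Walk v v), IsHole G c ∧ IsHoleSubordinate A c x

/-- `H` is a subdivision of `G` via the branch-vertex embedding `f` and the system of
paths `P` replacing the edges of `G`. -/
def IsSubdivisionVia {V W : Type} (H : SimpleGraph W) (G : SimpleGraph V) (f : V ↪ W)
    (P : ∀ ⦃u v : V⦄, G.Adj u v → H.Walk (f u) (f v)) : Prop :=
  (∀ ⦃u v⦄ (h : G.Adj u v), (P h).IsPath ∧ 1 ≤ (P h).length) ∧
  (∀ ⦃u v⦄ (h : G.Adj u v) (x : V), f x ∈ (P h).support → x = u ∨ x = v) ∧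
  (∀ ⦃u v u' v'⦄ (h : G.Adj u v) (h' : G.Adj u' v'), s(u, v) ≠ s(u', v') →
    ∀ w, w ∈ (P h).support → w ∈ (P h').support → ∃ x : V, w = f x) ∧
  (∀ w : W, ∃ u v, ∃ h : G.Adj u v, w ∈ (P h).support) ∧
  (∀ ⦃x y : W⦄, H.Adj x y → ∃ u v, ∃ h : G.Adj u v, s(x, y) ∈ (P h).edges)

/-- `H` is a subdivision of `G`. -/
def IsSubdivision {V W : Type} (H : SimpleGraph W) (G : SimpleGraph V) : Prop :=
  ∃ (f : V ↪ W) (P : ∀ ⦃u v : V⦄, G.Adj u v → H.Walk (f u) (f v)), IsSubdivisionVia H G f P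

/-- `G` contains an induced copy of `H`. -/
def InducedCopy {V W : Type} (H : SimpleGraph W) (G : SimpleGraph V) : Prop :=
  ∃ f : W ↪ V, ∀ a b, H.Adj a b ↔ G.Adj (f a) (f b)

/-- The clique number of a graph. -/
noncomputable def cliqueNumber {V : Type} (G : SimpleGraph V) : ℕ :=
  sSup {n | ∃ s : Finset V, G.IsNClique n s}

/-- `G` belongs to `Forb*(H)`: it has no induced subdivision of `H`. -/
def InForbs {VH V : Type} (H : SimpleGraph VH) (G : SimpleGraph V) : Prop :=
  ∀ (U : Type) (S : SimpleGraph U), IsSubdivision S H → ¬ InducedCopy S G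

/-- `H` is weakly pervasive: the class `Forb*(H)` (of finite graphs) is χ-bounded. -/
def WeaklyPervasive {VH : Type} (H : SimpleGraph VH) : Prop :=
  ∃ f : ℕ → ℕ, ∀ (V : Type) (_ : Fintype V) (G : SimpleGraph V),
    InForbs H G → G.chromaticNumber ≤ (f (cliqueNumber G) : ℕ∞)

/-- `G` has a star cutset centered at `v`. -/
def HasStarCutsetAt {V : Type} (G : SimpleGraph V) (v : V) : Prop :=
  ∃ S : Set V, v ∈ S ∧ (∀ u ∈ S, u = v ∨ G.Adj v u) ∧ ¬ (G.induce Sᶜ).Preconnected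

/-- `G` has a star cutset. -/
def HasStarCutset {V : Type} (G : SimpleGraph V) : Prop :=
  ∃ v, HasStarCutsetAt G v

/-- The structure of an `m`-necklace on the graph `G`: beads `B i` (chordless cycles of
length at least 4 through the non-adjacent vertices `a i`, `b i`) joined cyclically by
paths `P i` from `b i` to `a (i+1)` (of length possibly 0, i.e. identification),
with no further vertices or edges. -/
structure Necklace {V : Type} (G : SimpleGraph V) (m : ℕ) where
  a : ZMod m → V
  b : ZMod m → V
  B : ∀ i, G.Walk (a i) (a i)
  P : ∀ i, G.Walk (b i) (a (i + 1))
  B_cycle : ∀ i, (B i).IsCycle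
  B_len : ∀ i, 4 ≤ (B i).length
  b_mem : ∀ i, b i ∈ (B i).support
  ab_ne : ∀ i, a i ≠ b i
  ab_nonadj : ∀ i, ¬ G.Adj (a i) (b i)
  P_path : ∀ i, (P i).IsPath
  bead_disjoint : ∀ i j, i ≠ j → ∀ x, x ∈ (B i).support → x ∈ (B j).support →
    (j = i + 1 ∧ x = b i ∧ x = a j) ∨ (i = j + 1 ∧ x = b j ∧ x = a i)
  path_bead_disjoint : ∀ i j (x : V), x ∈ (P i).support → x ∈ (B j).support →
    x = b i ∨ x = a (i + 1)
  path_disjoint : ∀ i j, i ≠ j → ∀ x, x ∈ (P i).support → x ∈ (P j).support →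
    (x = b i ∨ x = a (i + 1)) ∧ (x = b j ∨ x = a (j + 1))
  cover_vertex : ∀ x : V, (∃ i, x ∈ (B i).support) ∨ ∃ i, x ∈ (P i).support
  cover_edge : ∀ x y, G.Adj x y → (∃ i, s(x, y) ∈ (B i).edges) ∨ ∃ i, s(x, y) ∈ (P i).edges

/-- The bead `B i` of a necklace is short if `a i` and `b i` have a common neighbour. -/
def Necklace.Short {V : Type} {G : SimpleGraph V} {m : ℕ} (N : Necklace G m)
    (i : ZMod m) : Prop :=
  ∃ w, G.Adj (N.a i) w ∧ G.Adj (N.b i) w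

/-- A chandelier: an in-tree (given by a parent function on `V \ {hub}`) with at least two
leaves, together with an extra vertex `hub` joined to all the leaves. -/
structure Chandelier (V : Type) where
  hub : V
  root : V
  parent : V → V
  hub_ne_root : hub ≠ root
  parent_root : parent root = root
  parent_hub : parent hub = hub
  parent_ne_hub : ∀ u, u ≠ hub → parent u ≠ hub
  reach : ∀ u, u ≠ hub → ∃ n, parent^[n] u = root
  two_leaves : ∃ l₁ l₂ : V, l₁ ≠ l₂ ∧
    (l₁ ≠ hub ∧ l₁ ≠ root ∧ ∀ w, parent w = l₁ → w = l₁) ∧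
    (l₂ ≠ hub ∧ l₂ ≠ root ∧ ∀ w, parent w = l₂ → w = l₂)

/-- A leaf of the in-tree of a chandelier. -/
def Chandelier.IsLeaf {V : Type} (C : Chandelier V) (u : V) : Prop :=
  u ≠ C.hub ∧ u ≠ C.root ∧ ∀ w, C.parent w = u → w = u

/-- The arcs of (the oriented version of) a chandelier. -/
def Chandelier.Arc {V : Type} (C : Chandelier V) (u w : V) : Prop :=
  (u ≠ C.hub ∧ u ≠ C.root ∧ w = C.parent u) ∨ (C.IsLeaf u ∧ w = C.hub)

/-- The underlying (non-oriented) graph of a chandelier. -/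
def Chandelier.graph {V : Type} (C : Chandelier V) : SimpleGraph V :=
  SimpleGraph.fromRel C.Arc

/-- There is a vertex lying on every cycle of the graph. -/
def HasUniversalCycleVertex {V : Type} (G : SimpleGraph V) : Prop :=
  ∃ x : V, ∀ (w : V) (c : G.Walk w w), c.IsCycle → x ∈ c.support

/-- A Burling-admissible type-4 subdivision of `K₄` sitting inside `G`: branch vertices
`x, y, z, w`, where the two non-subdivided edges `xy`, `xz` share the endpoint `x`, and the
four other edges are replaced by internally disjoint paths of length at least 2. -/
structure Type4K4Core {V : Type} (G : SimpleGraph V) where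
  x : V
  y : V
  z : V
  w : V
  ne_xy : x ≠ y
  ne_xz : x ≠ z
  ne_xw : x ≠ w
  ne_yz : y ≠ z
  ne_yw : y ≠ w
  ne_zw : z ≠ w
  adj_xy : G.Adj x y
  adj_xz : G.Adj x z
  Pxw : G.Walk x w
  Pyz : G.Walk y z
  Pyw : G.Walk y w
  Pzw : G.Walk z w
  Pxw_path : Pxw.IsPath
  Pyz_path : Pyz.IsPath
  Pyw_path : Pyw.IsPath
  Pzw_path : Pzw.IsPath
  Pxw_len : 2 ≤ Pxw.length
  Pyz_len : 2 ≤ Pyz.length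
  Pyw_len : 2 ≤ Pyw.length
  Pzw_len : 2 ≤ Pzw.length
  d₁ : ∀ v, v ∈ Pxw.support → v ∈ Pyz.support → False
  d₂ : ∀ v, v ∈ Pxw.support → v ∈ Pyw.support → v = w
  d₃ : ∀ v, v ∈ Pxw.support → v ∈ Pzw.support → v = w
  d₄ : ∀ v, v ∈ Pyz.support → v ∈ Pyw.support → v = y
  d₅ : ∀ v, v ∈ Pyz.support → v ∈ Pzw.support → v = z
  d₆ : ∀ v, v ∈ Pyw.support → v ∈ Pzw.support → v = w

/-- The vertex set of a type-4 `K₄`-subdivision configuration. -/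
def Type4K4Core.supp {V : Type} {G : SimpleGraph V} (c : Type4K4Core G) : Set V :=
  {v | v ∈ c.Pxw.support ∨ v ∈ c.Pyz.support ∨ v ∈ c.Pyw.support ∨ v ∈ c.Pzw.support}

/-- The edge set of a type-4 `K₄`-subdivision configuration. -/
def Type4K4Core.edges {V : Type} {G : SimpleGraph V} (c : Type4K4Core G) : Set (Sym2 V) :=
  {e | e ∈ c.Pxw.edges ∨ e ∈ c.Pyz.edges ∨ e ∈ c.Pyw.edges ∨ e ∈ c.Pzw.edges ∨
    e = s(c.x, c.y) ∨ e = s(c.x, c.z)}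

/-- The configuration exhausts the whole graph `G`. -/
def Type4K4Core.Spanning {V : Type} {G : SimpleGraph V} (c : Type4K4Core G) : Prop :=
  (∀ v : V, v ∈ c.supp) ∧ ∀ u v, G.Adj u v → s(u, v) ∈ c.edges

/-- A vertex of degree exactly 2. -/
def DegTwo {V : Type} (G : SimpleGraph V) (x : V) : Prop :=
  ∃ p q, p ≠ q ∧ G.Adj x p ∧ G.Adj x q ∧ ∀ r, G.Adj x r → r = p ∨ r = q


namespace BurlingTree

variable {V : Type} (T : BurlingTree V)

def anc (a b : V) : Prop := ∃ n, T.parent^[n] b = a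

open Classical in
noncomputable def dep (v : V) : ℕ := Nat.find (T.reach v)

def D (v z : V) : Prop := T.anc v z ∧ z ≠ v

lemma parent_iter_root (n : ℕ) : T.parent^[n] T.root = T.root := by
  induction n with
  | zero => rfl
  | succ n ih => rw [Function.iterate_succ_apply, T.parent_root, ih]

lemma dep_spec (v : V) : T.parent^[T.dep v] v = T.root := by
  classical
  exact Nat.find_spec (T.reach v)

lemma dep_le {v : V} {n : ℕ} (h : T.parent^[n] v = T.root) : T.dep v ≤ n := by
  classical
  exact Nat.find_min' (T.reach v) h

lemma dep_root : T.dep T.root = 0 := by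
  have := T.dep_le (v := T.root) (n := 0) rfl
  omega

lemma eq_root_of_dep {v : V} (h : T.dep v = 0) : v = T.root := by
  have := T.dep_spec v
  rwa [h] at this

lemma dep_parent (v : V) : T.dep (T.parent v) = T.dep v - 1 := by
  by_cases hv : v = T.root
  · subst hv; rw [T.parent_root, dep_root]
  · have h0 : T.dep v ≠ 0 := fun h => hv (T.eq_root_of_dep h)
    apply le_antisymm
    · apply T.dep_le
      rw [← Function.iterate_succ_apply, Nat.succ_eq_add_one, Nat.sub_add_cancel (by omega)]
      exact T.dep_spec v
    · have := T.dep_le (v := v) (n := T.dep (T.parent v) + 1)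
        (by rw [Function.iterate_succ_apply]; exact T.dep_spec _)
      omega

lemma dep_iter (n : ℕ) (v : V) : T.dep (T.parent^[n] v) = T.dep v - n := by
  induction n with
  | zero => rfl
  | succ n ih => rw [Function.iterate_succ_apply', dep_parent, ih]; omega

lemma anc_refl (a : V) : T.anc a a := ⟨0, rfl⟩

lemma anc_trans {a b c : V} (h : T.anc a b) (h' : T.anc b c) : T.anc a c := by
  obtain ⟨n, rfl⟩ := h
  obtain ⟨m, rfl⟩ := h'
  exact ⟨n + m, by rw [Function.iterate_add_apply]⟩

lemma anc_dep {a b : V} (h : T.anc a b) : T.dep a ≤ T.dep b := by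
  obtain ⟨n, rfl⟩ := h
  rw [dep_iter]; omega

lemma anc_eq_of_dep {a b : V} (h : T.anc a b) (hd : T.dep b ≤ T.dep a) : a = b := by
  obtain ⟨n, rfl⟩ := h
  rw [dep_iter] at hd
  rcases Nat.eq_zero_or_pos n with h0 | h0
  · subst h0; rfl
  · have : T.dep b = 0 := by omega
    rw [T.eq_root_of_dep this, parent_iter_root]

lemma anc_antisymm {a b : V} (h : T.anc a b) (h' : T.anc b a) : a = b :=
  T.anc_eq_of_dep h (T.anc_dep h')

lemma anc_comp {a b c : V} (h : T.anc a c) (h' : T.anc b c) : T.anc a b ∨ T.anc b a := by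
  obtain ⟨n, rfl⟩ := h
  obtain ⟨m, rfl⟩ := h'
  rcases le_total n m with h | h
  · right; exact ⟨m - n, by rw [← Function.iterate_add_apply, Nat.sub_add_cancel h]⟩
  · left; exact ⟨n - m, by rw [← Function.iterate_add_apply, Nat.sub_add_cancel h]⟩

lemma anc_parent (a : V) : T.anc (T.parent a) a := ⟨1, rfl⟩

lemma anc_parent_of_ne {a b : V} (h : T.anc a b) (hne : b ≠ a) : T.anc a (T.parent b) := by
  obtain ⟨n, rfl⟩ := h
  cases n with
  | zero => exact absurd rfl hne
  | succ n => exact ⟨n, by rw [Function.iterate_succ_apply]⟩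

lemma parent_ne {v : V} (h : v ≠ T.root) : T.parent v ≠ v := by
  intro h'
  obtain ⟨n, hn⟩ := T.reach v
  exact h (by rw [← hn, Function.iterate_fixed h'])

/-- elements of a branch descend from its start -/
lemma branch_anc {u : V} {S : Set V}
    (h1 : ∀ w ∈ S, w ≠ u → T.parent w ∈ S ∧ T.parent w ≠ w) :
    ∀ n w, w ∈ S → T.dep w = n → T.anc u w := by
  intro n
  induction n with
  | zero =>
    intro w hw hd
    by_cases hu : w = u
    · subst hu; exact T.anc_refl _
    · have := (h1 w hw hu).2
      rw [T.eq_root_of_dep hd, T.parent_root] at this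
      exact absurd rfl this
  | succ n ih =>
    intro w hw hd
    by_cases hu : w = u
    · subst hu; exact T.anc_refl _
    · exact T.anc_trans (ih _ (h1 w hw hu).1 (by rw [dep_parent, hd]; rfl)) (T.anc_parent w)

lemma arc_base {y z : V} (h : T.Arc y z) :
    y ≠ T.root ∧ y ≠ T.lastBorn (T.parent y) ∧
    T.parent (T.lastBorn (T.parent y)) = T.parent y ∧ T.lastBorn (T.parent y) ≠ T.parent y ∧
    (T.lastBorn (T.parent y) ∈ T.choosePath y ∧
      (∀ w ∈ T.choosePath y, w ≠ T.lastBorn (T.parent y) →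
        T.parent w ∈ T.choosePath y ∧ T.parent w ≠ w) ∧
    ∀ w ∈ T.choosePath y, ∀ w' ∈ T.choosePath y, w ≠ T.lastBorn (T.parent y) →
      w' ≠ T.lastBorn (T.parent y) → T.parent w = T.parent w' → w = w') := by
  have hy : ¬ (y = T.root ∨ y = T.lastBorn (T.parent y)) := by
    intro h'
    have := T.choosePath_empty y h'
    unfold Arc at h
    rw [this] at h
    exact h
  push Not at hy
  obtain ⟨hr, hl⟩ := hy
  have h2 := T.lastBorn_child (T.parent y) ⟨y, (T.parent_ne hr).symm, rfl⟩
  refine ⟨hr, hl, h2.1, h2.2, ?_⟩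
  rcases T.choosePath_branch y hr hl with h' | h'
  · unfold Arc at h
    rw [h'] at h
    exact absurd h (by simp)
  · exact h'

lemma arc_anc {y z : V} (h : T.Arc y z) : T.anc (T.lastBorn (T.parent y)) z := by
  obtain ⟨-, -, -, -, -, h1, -⟩ := T.arc_base h
  exact T.branch_anc h1 _ z h rfl

lemma arc_up {y z v : V} (h : T.Arc y z) (hv : T.anc v z)
    (hb : T.anc (T.lastBorn (T.parent y)) v) : T.Arc y v := by
  obtain ⟨-, -, -, -, hb0, h1, -⟩ := T.arc_base h
  obtain ⟨n, rfl⟩ := hv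
  induction n with
  | zero => exact h
  | succ n ih =>
    rw [Function.iterate_succ_apply'] at hb ⊢
    have := ih (T.anc_trans hb (T.anc_parent _))
    by_cases he : T.parent^[n] z = T.lastBorn (T.parent y)
    · have : T.parent (T.parent^[n] z) = T.parent^[n] z := by
        apply T.anc_antisymm (T.anc_parent _)
        rw [he] at hb ⊢
        exact hb
      rw [this]; assumption
    · exact (h1 _ this he).1

lemma arc_comp {y z z' : V} (h : T.Arc y z) (h' : T.Arc y z') (hle : T.dep z ≤ T.dep z') :
    T.anc z z' := by
  have hb := T.arc_base h
  obtain ⟨-, -, -, -, hb0, h1, h2⟩ := hb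
  have key : ∀ n w w', T.Arc y w → T.Arc y w' → T.dep w = n → T.dep w' = n → w = w' := by
    intro n
    induction n with
    | zero =>
      intro w w' _ _ e e'
      rw [T.eq_root_of_dep e, T.eq_root_of_dep e']
    | succ n ih =>
      intro w w' hw hw' e e'
      by_cases hwl : w = T.lastBorn (T.parent y)
      · apply T.anc_eq_of_dep
        · rw [hwl]; exact T.arc_anc hw'
        · omega
      by_cases hwl' : w' = T.lastBorn (T.parent y)
      · symm
        apply T.anc_eq_of_dep
        · rw [hwl']; exact T.arc_anc hw
        · omega
      · apply h2 w hw w' hw' hwl hwl'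
        apply ih _ _ (h1 w hw hwl).1 (h1 w' hw' hwl').1
        · rw [dep_parent, e]; rfl
        · rw [dep_parent, e']; rfl
  set k := T.dep z' - T.dep z
  have hk : T.dep (T.parent^[k] z') = T.dep z := by rw [dep_iter]; omega
  have hm : T.Arc y (T.parent^[k] z') := by
    apply T.arc_up h' ⟨k, rfl⟩
    rcases T.anc_comp (T.arc_anc h') ⟨k, rfl⟩ with h3 | h3
    · exact h3
    · have : T.parent^[k] z' = T.lastBorn (T.parent y) := by
        apply T.anc_eq_of_dep h3
        rw [hk]; exact T.anc_dep (T.arc_anc h)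
      rw [this]; exact T.anc_refl _
  exact ⟨k, (key _ _ _ h hm rfl hk).symm⟩

lemma D_antisymm {a b : V} (h : T.D a b) (h' : T.D b a) : False :=
  h.2 (T.anc_antisymm h'.1 h.1)

lemma arc_not_D {y z : V} (h : T.Arc y z) : ¬ T.D y z ∧ ¬ T.D z y := by
  obtain ⟨hr, hl, hp, hpn, -⟩ := T.arc_base h
  have ha := T.arc_anc h
  constructor
  · rintro ⟨h1, h2⟩
    have hdl : T.dep (T.lastBorn (T.parent y)) = T.dep y := by
      have e := T.dep_parent (T.lastBorn (T.parent y))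
      rw [hp, dep_parent] at e
      have : T.dep y ≠ 0 := fun h => hr (T.eq_root_of_dep h)
      have : T.dep (T.lastBorn (T.parent y)) ≠ 0 := by
        intro h
        have h3 := T.eq_root_of_dep h
        rw [h3, T.parent_root] at hp
        exact hpn (h3.trans hp)
      omega
    rcases T.anc_comp ha h1 with h3 | h3
    · exact hl (T.anc_eq_of_dep h3 (by omega)).symm
    · exact hl (T.anc_eq_of_dep h3 (by omega))
  · rintro ⟨h1, h2⟩
    have h3 := T.anc_parent_of_ne h1 h2
    have h4 := T.anc_trans ha h3
    have h5 := T.anc_parent (T.lastBorn (T.parent y))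
    rw [hp] at h5
    exact hpn (T.anc_antisymm h4 h5)

/-- edges leaving the set of strict descendants of `v` -/
lemma exit_arc {v y z : V} (h : T.Arc y z ∨ T.Arc z y) (hz : T.D v z) (hy : ¬ T.D v y)
    (hyv : y ≠ v) : T.Arc y v ∧ T.Arc y z := by
  rcases h with h | h
  · refine ⟨?_, h⟩
    apply T.arc_up h hz.1
    rcases T.anc_comp (T.arc_anc h) hz.1 with h3 | h3
    · exact h3
    · obtain ⟨hr, hl, hp, hpn, -⟩ := T.arc_base h
      by_cases he : T.lastBorn (T.parent y) = v
      · rw [he]; exact T.anc_refl _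
      · exfalso
        have := T.anc_parent_of_ne h3 he
        rw [hp] at this
        exact hy ⟨T.anc_trans this (T.anc_parent _), hyv⟩
  · exfalso
    obtain ⟨hr, hl, hp, hpn, -⟩ := T.arc_base h
    have h1 := T.anc_parent_of_ne hz.1 hz.2
    have h2 := T.arc_anc h
    have h3 := T.anc_parent (T.lastBorn (T.parent z))
    rw [hp] at h3
    exact hy ⟨T.anc_trans h1 (T.anc_trans h3 h2), hyv⟩

lemma arc_dep {y z : V} (h : T.Arc y z) : T.dep (T.parent y) ≤ T.dep (T.parent z) ∧
    (T.dep (T.parent z) ≤ T.dep (T.parent y) →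
      z = T.lastBorn (T.parent y) ∧ T.parent z = T.parent y) := by
  obtain ⟨hr, hl, hp, hpn, -⟩ := T.arc_base h
  have ha := T.arc_anc h
  by_cases he : z = T.lastBorn (T.parent y)
  · have : T.parent z = T.parent y := by rw [he, hp]
    rw [this]
    exact ⟨le_rfl, fun _ => ⟨he, rfl⟩⟩
  · have h1 := T.anc_dep (T.anc_parent_of_ne ha he)
    have e := T.dep_parent (T.lastBorn (T.parent y))
    rw [hp] at e
    have : T.dep (T.lastBorn (T.parent y)) ≠ 0 := by
      intro h
      have h3 := T.eq_root_of_dep h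
      rw [h3, T.parent_root] at hp
      exact hpn (h3.trans hp)
    constructor
    · omega
    · intro; omega

end BurlingTree

/-- base lemma, cycle based at the source -/
lemma hole_base {W U : Type} {G : SimpleGraph W} {A : W → W → Prop} (hO : IsOrientation G A)
    (T : BurlingTree U) (f : W ↪ U) (hA : ∀ u v, A u v ↔ T.Arc (f u) (f v))
    {s : W} (c : G.Walk s s) (hc : IsHole G c) (hs : IsHoleSource A c s)
    (hD : T.D (f (c.getVert (c.length - 1))) (f (c.getVert 1))) :
    ∃ p y, s ≠ y ∧ s(p, s) ∈ c.edges ∧ s(p, y) ∈ c.edges ∧ IsHoleSource A c y ∧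
      ∀ t ∈ c.support, t = p ∨ t = s ∨ t = y ∨ T.D (f p) (f t) := by
  obtain ⟨⟨hcyc, hch⟩, hlen⟩ := hc
  set n := c.length with hn
  have hinj := hcyc.getVert_injOn'
  have inj : ∀ i j, i < n → j < n → c.getVert i = c.getVert j → i = j := by
    intro i j hi hj h
    exact hinj (by simp only [Set.mem_ofPred_eq]; omega) (by simp only [Set.mem_ofPred_eq]; omega) h
  have g0 : c.getVert 0 = s := c.getVert_zero
  have gn : c.getVert n = c.getVert 0 := by rw [hn, c.getVert_length, g0]
  have hadj : ∀ i, i < n → s(c.getVert i, c.getVert (i+1)) ∈ c.edges := fun i hi =>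
    (c.mk_mem_edges_iff_exists).2 ⟨i, hi, rfl⟩
  have hedge : ∀ i z, 0 < i → i < n → s(c.getVert i, z) ∈ c.edges →
      z = c.getVert (i+1) ∨ z = c.getVert (i-1) := by
    intro i z h0 hi he
    obtain ⟨j, hj, e⟩ := (c.mk_mem_edges_iff_exists).1 he
    rw [Sym2.eq_iff] at e
    rcases e with ⟨e1, e2⟩ | ⟨e1, e2⟩
    · have := inj _ _ hj hi e1
      subst this
      exact Or.inl e2.symm
    · right
      rcases Nat.lt_or_ge (j+1) n with h | h
      · have := inj _ _ h hi e2
        rw [← e1, ← this]; rfl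
      · have h' : j + 1 = n := by omega
        rw [h', gn] at e2
        have := inj _ _ (by omega) hi e2
        omega
  have hsrc_adj : ∀ a b, s(a,b) ∈ c.edges → T.Arc (f a) (f b) ∨ T.Arc (f b) (f a) := by
    intro a b h
    have h1 := c.adj_of_mem_edges h
    rw [← hA, ← hA]
    by_cases hh : A a b
    · exact Or.inl hh
    · right
      by_contra h3
      exact hh ((hO.2 a b h1).2 h3)
  set p := c.getVert (n-1) with hp
  have hnadj : ∀ i, 1 ≤ i → i ≤ n - 3 → ¬ G.Adj (c.getVert i) p := by
    intro i h1 h2 h3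
    have := hch _ _ (c.getVert_mem_support i) (c.getVert_mem_support (n-1)) h3
    rcases hedge i p (by omega) (by omega) this with h | h
    · have := inj _ _ (by omega) (by omega) h; omega
    · have := inj _ _ (by omega) (by omega) h; omega
  have key : ∀ i, 1 ≤ i → i ≤ n - 3 → T.D (f p) (f (c.getVert i)) := by
    intro i h1
    induction i, h1 using Nat.le_induction with
    | base => intro _; exact hD
    | succ i h1 ih =>
      intro h2
      have h3 := ih (by omega)
      by_contra h4
      have h5 := T.exit_arc (v := f p) (hsrc_adj _ _ (hadj i (by omega))).symm h3 h4 (by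
        intro h; have := inj _ _ (by omega) (by omega) (f.injective h); omega)
      exact hnadj (i+1) (by omega) h2 (hO.1 _ _ ((hA _ _).2 h5.1))
  have e1 := hadj (n-1) (by omega)
  rw [Nat.sub_add_cancel (by omega), gn, g0] at e1
  have e2 := hadj (n-2) (by omega)
  rw [show n - 2 + 1 = n - 1 by omega] at e2
  have e3 := hadj (n-3) (by omega)
  rw [show n - 3 + 1 = n - 2 by omega] at e3
  have hyD : ¬ T.D (f p) (f (c.getVert (n-2))) := by
    rcases hsrc_adj _ _ e2 with h | h
    · exact (T.arc_not_D h).2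
    · exact (T.arc_not_D h).1
  have hex := T.exit_arc (v := f p) (hsrc_adj _ _ e3).symm (key (n-3) (by omega) le_rfl) hyD (by
        intro h; have := inj _ _ (by omega) (by omega) (f.injective h); omega)
  refine ⟨p, c.getVert (n-2), ?_, e1, by rw [Sym2.eq_swap]; exact e2, ⟨c.getVert_mem_support _, ?_⟩, ?_⟩
  · intro h
    have := inj 0 (n-2) (by omega) (by omega) (g0.trans h); omega
  · intro z hz
    rw [hA]
    rcases hedge _ _ (by omega) (by omega) hz with h | h
    · rw [h, show n - 2 + 1 = n - 1 by omega]; exact hex.1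
    · rw [h, show n - 2 - 1 = n - 3 by omega]; exact hex.2
  · intro t ht
    obtain ⟨i, hi, hil⟩ := Walk.mem_support_iff_exists_getVert.1 ht
    rw [← hn] at hil
    by_cases h0 : i = 0 ∨ i = n
    · right; left
      rcases h0 with h0 | h0
      · rw [← hi, h0, g0]
      · rw [← hi, h0, gn, g0]
    by_cases h1 : i = n - 1
    · left; rw [← hi, h1]
    by_cases h2 : i = n - 2
    · right; right; left; rw [← hi, h2]
    right; right; right
    rw [← hi]; exact key i (by omega) (by omega)

lemma hole_of_eq {W : Type} {G : SimpleGraph W} {a b : W} {c : G.Walk a a} {c' : G.Walk b b}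
    (hc : IsHole G c) (hcyc : c'.IsCycle) (hl : c'.length = c.length)
    (hs : ∀ w, w ∈ c'.support ↔ w ∈ c.support) (he : ∀ e, e ∈ c'.edges ↔ e ∈ c.edges) :
    IsHole G c' := by
  refine ⟨⟨hcyc, ?_⟩, by rw [hl]; exact hc.2⟩
  intro x y hx hy h
  rw [he]
  exact hc.1.2 x y ((hs _).1 hx) ((hs _).1 hy) h

lemma hole_src {W U : Type} {G : SimpleGraph W} {A : W → W → Prop} (hO : IsOrientation G A)
    (T : BurlingTree U) (f : W ↪ U) (hA : ∀ u v, A u v ↔ T.Arc (f u) (f v))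
    {b s : W} (c : G.Walk b b) (hc : IsHole G c) (hs : IsHoleSource A c s) :
    ∃ p y, s ≠ y ∧ s(p, s) ∈ c.edges ∧ s(p, y) ∈ c.edges ∧ IsHoleSource A c y ∧
      ∀ t ∈ c.support, t = p ∨ t = s ∨ t = y ∨ T.D (f p) (f t) := by
  classical
  let c1 := c.rotate s hs.1
  have he1 : ∀ e, e ∈ c1.edges ↔ e ∈ c.edges := fun e => (c.rotate_edges s hs.1).mem_iff
  have hs1 : ∀ w, w ∈ c1.support ↔ w ∈ c.support := fun w => c.mem_support_rotate_iff s hs.1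
  have hc1 : IsHole G c1 := hole_of_eq hc (hc.1.1.rotate hs.1) (c.length_rotate s hs.1) hs1 he1
  have hsrc1 : ∀ t, IsHoleSource A c1 t ↔ IsHoleSource A c t := by
    intro t; unfold IsHoleSource; simp only [he1, hs1]
  let c2 := c1.reverse
  have he2 : ∀ e, e ∈ c2.edges ↔ e ∈ c.edges := fun e => by
    rw [← he1]; simp [c2]
  have hs2 : ∀ w, w ∈ c2.support ↔ w ∈ c.support := fun w => by
    rw [← hs1]; simp [c2]
  have hl2 : c2.length = c1.length := by simp [c2]
  have hc2 : IsHole G c2 := hole_of_eq hc (hc1.1.1.reverse) (hl2.trans (c.length_rotate s hs.1)) hs2 he2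
  have hsrc2 : ∀ t, IsHoleSource A c2 t ↔ IsHoleSource A c t := by
    intro t; unfold IsHoleSource; simp only [he2, hs2]
  have hlen := hc1.2
  have hne : f (c1.getVert 1) ≠ f (c1.getVert (c1.length - 1)) := by
    intro h
    have := hc1.1.1.getVert_injOn' (by simp only [Set.mem_ofPred_eq]; omega)
      (by simp only [Set.mem_ofPred_eq]; omega) (f.injective h)
    omega
  have a1 : T.Arc (f s) (f (c1.getVert 1)) := by
    rw [← hA]
    apply hs.2
    rw [← he1]
    exact (c1.mk_mem_edges_iff_exists).2 ⟨0, by omega, by simp⟩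
  have a2 : T.Arc (f s) (f (c1.getVert (c1.length - 1))) := by
    rw [← hA]
    apply hs.2
    rw [← he1]
    refine (c1.mk_mem_edges_iff_exists).2 ⟨c1.length - 1, by omega, ?_⟩
    rw [Nat.sub_add_cancel (by omega), c1.getVert_length, Sym2.eq_swap]
  rcases le_total (T.dep (f (c1.getVert 1))) (T.dep (f (c1.getVert (c1.length - 1)))) with h | h
  · have := hole_base hO T f hA c2 hc2 ((hsrc2 s).2 hs) (by
      simp only [c2, Walk.getVert_reverse, Walk.length_reverse]
      rw [show c1.length - (c1.length - 1) = 1 by omega]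
      exact ⟨T.arc_comp a1 a2 h, hne.symm⟩)
    simpa only [he2, hs2, hsrc2] using this
  · have := hole_base hO T f hA c1 hc1 ((hsrc1 s).2 hs) ⟨T.arc_comp a2 a1 h, hne⟩
    simpa only [he1, hs1, hsrc1] using this

lemma hole_has_source {W U : Type} {G : SimpleGraph W} {A : W → W → Prop} (hO : IsOrientation G A)
    (T : BurlingTree U) (f : W ↪ U) (hA : ∀ u v, A u v ↔ T.Arc (f u) (f v))
    {b : W} (c : G.Walk b b) : ∃ s, IsHoleSource A c s := by
  classical
  obtain ⟨s, hs, hmin⟩ := Finset.exists_min_image c.support.toFinset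
    (fun w => T.dep (T.parent (f w))) ⟨b, by simp⟩
  simp only [List.mem_toFinset] at hs hmin
  by_cases hss : IsHoleSource A c s
  · exact ⟨s, hss⟩
  have hflip : ∀ a b, s(a,b) ∈ c.edges → ¬ A a b → A b a := by
    intro a b h h2
    have h1 := c.adj_of_mem_edges h
    by_contra h3
    exact h2 ((hO.2 a b h1).2 h3)
  unfold IsHoleSource at hss
  push Not at hss
  obtain ⟨y, hy, hny⟩ := hss hs
  have hys := hflip _ _ hy hny
  have hyc : y ∈ c.support := c.snd_mem_support_of_mem_edges hy
  have h1 := T.arc_dep ((hA _ _).1 hys)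
  refine ⟨y, hyc, ?_⟩
  intro z hz
  by_contra hn
  have hzy := hflip _ _ hz hn
  have hzc : z ∈ c.support := c.snd_mem_support_of_mem_edges hz
  have h2 := T.arc_dep ((hA _ _).1 hzy)
  have h3 := hmin z hzc
  have h4 := h2.2 (by omega)
  have h5 := (T.arc_base ((hA _ _).1 hys)).2.1
  apply h5
  rw [h4.2]; exact h4.1

theorem hole_fact {W : Type} {G : SimpleGraph W} {A : W → W → Prop} (hB : IsOrientedBurling G A)
    {b : W} (c : G.Walk b b) (hc : IsHole G c) :
    ∃ p s y, s ≠ y ∧ s(p, s) ∈ c.edges ∧ s(p, y) ∈ c.edges ∧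
      IsHoleSource A c s ∧ IsHoleSource A c y ∧ ∀ t, IsHoleSource A c t → t = s ∨ t = y := by
  obtain ⟨hO, U, T, f, hA⟩ := hB
  obtain ⟨s, hs⟩ := hole_has_source hO T f hA c
  obtain ⟨p, y, hsy, hps, hpy, hy, hall⟩ := hole_src hO T f hA c hc hs
  refine ⟨p, s, y, hsy, hps, hpy, hs, hy, ?_⟩
  intro t ht
  obtain ⟨p', y', hty', hpt', hpy', hy', hall'⟩ := hole_src hO T f hA c hc ht
  have nsrc : ∀ p s, s(p,s) ∈ c.edges → IsHoleSource A c s → ¬ IsHoleSource A c p := by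
    intro p s h h1 h2
    have a1 := h2.2 s h
    have a2 := h1.2 p (by rw [Sym2.eq_swap]; exact h)
    exact (hO.2 p s (c.adj_of_mem_edges h)).1 a1 a2
  have np := nsrc p s hps hs
  have np' := nsrc p' t hpt' ht
  have tp' : T.Arc (f t) (f p') := (hA _ _).1 (ht.2 p' (by rw [Sym2.eq_swap]; exact hpt'))
  rcases hall t ht.1 with h | h | h | h
  · subst h; exact absurd ht np
  · exact Or.inl h
  · exact Or.inr h
  exfalso
  have hpp : p' ≠ p := by
    rintro rfl
    exact (T.arc_not_D tp').2 h
  have h1 : T.D (f p') (f p) := by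
    rcases hall' p (c.fst_mem_support_of_mem_edges hps) with h | h | h | h
    · exact absurd h.symm hpp
    · subst h; exact absurd ht np
    · subst h; exact absurd hy' np
    · exact h
  have h2 : T.D (f p) (f p') := by
    rcases hall p' (c.fst_mem_support_of_mem_edges hpt') with h | h | h | h
    · exact absurd h hpp
    · subst h; exact absurd hs np'
    · subst h; exact absurd hy np'
    · exact h
  exact T.D_antisymm h1 h2

lemma exists_induced_path {W : Type} (G : SimpleGraph W) (S : Set W) {a b : W} (p : G.Walk a b)
    (hp : ∀ w ∈ p.support, w ∈ S) :
    ∃ R : G.Walk a b, R.IsPath ∧ (∀ w ∈ R.support, w ∈ S) ∧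
      ∀ x y, x ∈ R.support → y ∈ R.support → G.Adj x y → s(x, y) ∈ R.edges := by
  classical
  have hex : ∃ n, ∃ R : G.Walk a b, R.length = n ∧ ∀ w ∈ R.support, w ∈ S := ⟨_, p, rfl, hp⟩
  obtain ⟨R, hRl, hRS⟩ := Nat.find_spec hex
  have hmin : ∀ R' : G.Walk a b, (∀ w ∈ R'.support, w ∈ S) → R.length ≤ R'.length := by
    intro R' h
    rw [hRl]
    exact Nat.find_min' hex ⟨R', rfl, h⟩
  have hmain : ∀ i j, i < j → j ≤ R.length → G.Adj (R.getVert i) (R.getVert j) → j = i + 1 := by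
    intro i j hij hj hadj
    have := hmin ((R.take i).append (Walk.cons hadj (R.drop j))) (by
      intro w hw
      rw [Walk.mem_support_append_iff] at hw
      apply hRS
      rcases hw with hw | hw
      · exact (R.isSubwalk_take i).support_subset hw
      · rw [Walk.support_cons, List.mem_cons] at hw
        rcases hw with rfl | hw
        · exact R.getVert_mem_support i
        · exact (R.isSubwalk_drop j).support_subset hw)
    simp only [Walk.length_append, Walk.length_cons, Walk.take_length, Walk.drop_length] at this
    omega
  refine ⟨R, ?_, hRS, ?_⟩
  · have h1 := hmin R.bypass (fun w hw => hRS w (R.support_bypass_subset_support hw))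
    rw [← R.bypass_eq_self_of_length_le_length_bypass h1]
    exact R.bypass_isPath
  · intro x y hx hy h
    obtain ⟨i, rfl, hi⟩ := Walk.mem_support_iff_exists_getVert.1 hx
    obtain ⟨j, rfl, hj⟩ := Walk.mem_support_iff_exists_getVert.1 hy
    rcases lt_trichotomy i j with hij | hij | hij
    · have := hmain i j hij hj h
      subst this
      exact (R.mk_mem_edges_iff_exists).2 ⟨i, by omega, rfl⟩
    · subst hij; exact absurd h (G.irrefl)
    · have := hmain j i hij hi h.symm
      subst this
      exact (R.mk_mem_edges_iff_exists).2 ⟨j, by omega, Sym2.eq_swap⟩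

/-- the part of the subdivision replacing the edge `e` -/
def gad {V W : Type} {G' : SimpleGraph W} {G : SimpleGraph V} {f : V ↪ W}
    (P : ∀ ⦃u v : V⦄, G.Adj u v → G'.Walk (f u) (f v)) (e : Sym2 V) : Set W :=
  {w | ∃ p q, ∃ h : G.Adj p q, s(p, q) = e ∧ w ∈ (P h).support}

section
variable {V W : Type} {G' : SimpleGraph W} {G : SimpleGraph V} {f : V ↪ W}
    {P : ∀ ⦃u v : V⦄, G.Adj u v → G'.Walk (f u) (f v)}

lemma gad_mem (hS : IsSubdivisionVia G' G f P) {z : V} {e : Sym2 V} (h : f z ∈ gad P e) : z ∈ e := by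
  obtain ⟨p, q, hpq, rfl, hw⟩ := h
  simpa using hS.2.1 hpq z hw

lemma gad_inter (hS : IsSubdivisionVia G' G f P) {w : W} {e e' : Sym2 V} (h : w ∈ gad P e)
    (h' : w ∈ gad P e') (hne : e ≠ e') : ∃ z, w = f z ∧ z ∈ e ∧ z ∈ e' := by
  have h0 := h
  have h0' := h'
  obtain ⟨p, q, hpq, rfl, hw⟩ := h
  obtain ⟨p', q', hpq', rfl, hw'⟩ := h'
  obtain ⟨z, rfl⟩ := hS.2.2.1 hpq hpq' hne w hw hw'
  exact ⟨z, rfl, gad_mem hS h0, gad_mem hS h0'⟩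

lemma gad_adj (hS : IsSubdivisionVia G' G f P) {x y : W} (h : G'.Adj x y) :
    ∃ p q, G.Adj p q ∧ x ∈ gad P s(p, q) ∧ y ∈ gad P s(p, q) := by
  obtain ⟨p, q, hpq, he⟩ := hS.2.2.2.2 h
  exact ⟨p, q, hpq, ⟨p, q, hpq, rfl, Walk.fst_mem_support_of_mem_edges _ he⟩,
    ⟨p, q, hpq, rfl, Walk.snd_mem_support_of_mem_edges _ he⟩⟩

lemma gad_of_cover (hS : IsSubdivisionVia G' G f P) {a b : V} {p : G.Walk a b} {w : W} {e : Sym2 V}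
    (hc : w = f b ∨ ∃ e ∈ p.edges, w ∈ gad P e) (hw : w ∈ gad P e) (he : e ∉ p.edges) :
    ∃ z, w = f z ∧ z ∈ e ∧ z ∈ p.support := by
  rcases hc with rfl | ⟨e', he', hw'⟩
  · exact ⟨b, rfl, gad_mem hS hw, p.end_mem_support⟩
  · obtain ⟨z, rfl, h1, h2⟩ := gad_inter hS hw hw' (by rintro rfl; exact he he')
    exact ⟨z, rfl, h1, Walk.mem_support_of_mem_edges he' h2⟩

lemma mem_pair_of {α : Type} {a b : α} {e : Sym2 α} (ha : a ∈ e) (hb : b ∈ e) (h : a ≠ b) :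
    e = s(a, b) := ((Sym2.mem_and_mem_iff h).1 ⟨ha, hb⟩)

lemma build (hS : IsSubdivisionVia G' G f P) {a b : V} (p : G.Walk a b) (hp : p.IsPath)
    (hch : ∀ x y, x ∈ p.support → y ∈ p.support → G.Adj x y → s(x, y) ∈ p.edges) :
    ∃ Q : G'.Walk (f a) (f b), Q.IsPath ∧ p.length ≤ Q.length ∧
      (∀ z ∈ p.support, f z ∈ Q.support) ∧
      (∀ w ∈ Q.support, w = f b ∨ ∃ e ∈ p.edges, w ∈ gad P e) ∧
      ∀ x y, x ∈ Q.support → y ∈ Q.support → G'.Adj x y → s(x, y) ∈ Q.edges := by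
  induction p with
  | nil =>
    refine ⟨Walk.nil, by simp, by simp, by simp, by simp, ?_⟩
    intro x y hx hy h
    simp at hx hy
    subst hx; subst hy
    exact absurd h (G'.irrefl)
  | @cons a b' b h p ih =>
    rw [Walk.cons_isPath_iff] at hp
    obtain ⟨hp, hap⟩ := hp
    have hch' : ∀ x y, x ∈ p.support → y ∈ p.support → G.Adj x y → s(x, y) ∈ p.edges := by
      intro x y hx hy hxy
      have := hch x y (by simp [hx]) (by simp [hy]) hxy
      rw [Walk.edges_cons, List.mem_cons] at this
      rcases this with h1 | h1
      · exfalso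
        rw [Sym2.eq_iff] at h1
        rcases h1 with ⟨rfl, rfl⟩ | ⟨rfl, rfl⟩
        · exact hap hx
        · exact hap hy
      · exact h1
    obtain ⟨Q, hQ, hQl, hQs, hQc, hQch⟩ := ih hp hch'
    obtain ⟨R, hR, hRs, hRch⟩ := exists_induced_path G' (gad P s(a, b')) (P h)
      (fun w hw => ⟨a, b', h, rfl, hw⟩)
    have hnot : s(a, b') ∉ p.edges := fun h1 => hap (p.fst_mem_support_of_mem_edges h1)
    have hint : ∀ w, w ∈ gad P s(a, b') → w ∈ Q.support → w = f b' := by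
      intro w hw hwQ
      obtain ⟨z, rfl, hz1, hz2⟩ := gad_of_cover hS (hQc w hwQ) hw hnot
      rw [Sym2.mem_iff] at hz1
      rcases hz1 with rfl | rfl
      · exact absurd hz2 hap
      · rfl
    have hcross : ∀ x y, x ∈ R.support → y ∈ Q.support → G'.Adj x y →
        s(x, y) ∈ R.edges ∨ s(x, y) ∈ Q.edges := by
      intro x y hx hy hxy
      obtain ⟨q, q', hqq, hxe, hye⟩ := gad_adj hS hxy
      by_cases he : s(q, q') = s(a, b')
      · rw [he] at hye
        have := hint y hye hy
        left
        exact hRch x y hx (by rw [this]; exact R.end_mem_support) hxy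
      · obtain ⟨z, rfl, hz1, hz2⟩ := gad_inter hS hxe (hRs x hx) he
        rw [Sym2.mem_iff] at hz2
        rcases hz2 with rfl | rfl
        · exfalso
          have hne : s(q, q') ∉ p.edges := fun h1 => hap (Walk.mem_support_of_mem_edges h1 hz1)
          obtain ⟨z', rfl, hz3, hz4⟩ := gad_of_cover hS (hQc y hy) hye hne
          have hzz : z ≠ z' := by rintro rfl; exact hap hz4
          have e1 := mem_pair_of hz1 hz3 hzz
          have hadj : G.Adj z z' := by
            rw [← SimpleGraph.mem_edgeSet, ← e1]; exact hqq
          have := hch z z' (by simp) (by simp [hz4]) hadj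
          rw [Walk.edges_cons, List.mem_cons] at this
          rcases this with h1 | h1
          · exact he (e1.trans h1)
          · exact hap (p.fst_mem_support_of_mem_edges h1)
        · right
          exact hQch _ y Q.start_mem_support hy hxy
    have hRl : 1 ≤ R.length := by
      rcases Nat.eq_zero_or_pos R.length with h0 | h0
      · exact absurd (f.injective (Walk.eq_of_length_eq_zero h0)) h.ne
      · exact h0
    refine ⟨R.append Q, ?_, ?_, ?_, ?_, ?_⟩
    · rw [Walk.isPath_def, Walk.support_append, List.nodup_append']
      refine ⟨hR.support_nodup, hQ.support_nodup.tail, ?_⟩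
      rw [List.disjoint_left]
      intro w hw1 hw2
      have := hint w (hRs w hw1) (List.mem_of_mem_tail hw2)
      subst this
      have hnd := hQ.support_nodup
      rw [← Walk.cons_tail_support] at hnd
      exact (List.nodup_cons.1 hnd).1 hw2
    · simp only [Walk.length_cons, Walk.length_append]; omega
    · intro z hz
      rw [Walk.mem_support_append_iff]
      rw [Walk.support_cons, List.mem_cons] at hz
      rcases hz with rfl | hz
      · exact Or.inl R.start_mem_support
      · exact Or.inr (hQs z hz)
    · intro w hw
      rw [Walk.mem_support_append_iff] at hw
      rw [Walk.edges_cons]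
      rcases hw with hw | hw
      · exact Or.inr ⟨_, by simp, hRs w hw⟩
      · rcases hQc w hw with h1 | ⟨e, he, h1⟩
        · exact Or.inl h1
        · exact Or.inr ⟨e, by simp [he], h1⟩
    · intro x y hx hy hxy
      rw [Walk.mem_support_append_iff] at hx hy
      rw [Walk.edges_append, List.mem_append]
      rcases hx with hx | hx <;> rcases hy with hy | hy
      · exact Or.inl (hRch x y hx hy hxy)
      · exact hcross x y hx hy hxy
      · rw [Sym2.eq_swap]; exact hcross y x hy hx hxy.symm
      · exact Or.inr (hQch x y hx hy hxy)

end

/-- two internally disjoint paths without chords form a hole -/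
lemma hole_of_paths {W : Type} {G : SimpleGraph W} {a b : W} {p q : G.Walk a b}
    (hp : p.IsPath) (hq : q.IsPath) (lp : 3 ≤ p.length) (lq : 3 ≤ q.length)
    (hd : ∀ w, w ∈ p.support → w ∈ q.support → w = a ∨ w = b)
    (hch : ∀ x y, (x ∈ p.support ∨ x ∈ q.support) → (y ∈ p.support ∨ y ∈ q.support) → G.Adj x y →
      s(x, y) ∈ p.edges ∨ s(x, y) ∈ q.edges) :
    IsHole G (p.append q.reverse) := by
  refine ⟨⟨?_, ?_⟩, ?_⟩
  · apply hp.isCycle_append hq.reverse _ (Or.inl (by omega))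
    rw [List.disjoint_left]
    intro w h1 h2
    have n1 := hp.support_nodup
    rw [← Walk.cons_tail_support] at n1
    have n2 := hq.reverse.support_nodup
    rw [← Walk.cons_tail_support] at n2
    have m1 := List.mem_of_mem_tail h1
    have m2 := List.mem_of_mem_tail h2
    rw [Walk.support_reverse, List.mem_reverse] at m2
    rcases hd w m1 m2 with rfl | rfl
    · exact (List.nodup_cons.1 n1).1 h1
    · exact (List.nodup_cons.1 n2).1 h2
  · intro x y hx hy h
    simp only [Walk.mem_support_append_iff, Walk.support_reverse, List.mem_reverse] at hx hy
    simpa using hch x y hx hy h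
  · simp; omega

lemma core_aux {W : Type} {G : SimpleGraph W} {A : W → W → Prop} (hB : IsOrientedBurling G A)
    {a b : W} {p q : G.Walk a b} (hH : IsHole G (p.append q.reverse))
    (hd : ∀ w, w ∈ p.support → w ∈ q.support → w = a ∨ w = b)
    {x s : W} (hx : x ∈ p.support) (hxa : x ≠ a) (hxb : x ≠ b) (hna : ¬ G.Adj a x)
    (hnb : ¬ G.Adj b x) (hs : s ∈ q.support) (hsa : s ≠ a) (hsb : s ≠ b)
    (hsrc : ∀ z, s(s, z) ∈ q.edges → A s z) :
    IsHoleSubordinate A (p.append q.reverse) x := by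
  have hxq : x ∉ q.support := fun h => by
    rcases hd x hx h with h | h
    · exact hxa h
    · exact hxb h
  have hsp : s ∉ p.support := fun h => by
    rcases hd s h hs with h | h
    · exact hsa h
    · exact hsb h
  have hxs : x ≠ s := by rintro rfl; exact hsp hx
  have hE : ∀ e, e ∈ (p.append q.reverse).edges ↔ e ∈ p.edges ∨ e ∈ q.edges := by
    intro e; simp
  have hsS : IsHoleSource A (p.append q.reverse) s := by
    refine ⟨by simp [hs], ?_⟩
    intro z hz
    rw [hE] at hz
    rcases hz with hz | hz
    · exact absurd (p.fst_mem_support_of_mem_edges hz) hsp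
    · exact hsrc z hz
  refine ⟨by simp [hx], ?_, ?_⟩
  · intro hxS
    obtain ⟨c, s', y', hne, h1, h2, -, -, hall⟩ := hole_fact hB _ hH
    have hc : ∀ t, IsHoleSource A (p.append q.reverse) t →
        s(c, t) ∈ (p.append q.reverse).edges := by
      intro t ht
      rcases hall t ht with rfl | rfl
      · exact h1
      · exact h2
    have e1 := hc x hxS
    have e2 := hc s hsS
    rw [hE] at e1 e2
    have hcp : s(c, x) ∈ p.edges := by
      rcases e1 with h | h
      · exact h
      · exact absurd (q.snd_mem_support_of_mem_edges h) hxq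
    have hcq : s(c, s) ∈ q.edges := by
      rcases e2 with h | h
      · exact absurd (p.snd_mem_support_of_mem_edges h) hsp
      · exact h
    have hadj := p.adj_of_mem_edges hcp
    rcases hd c (p.fst_mem_support_of_mem_edges hcp) (q.fst_mem_support_of_mem_edges hcq) with h | h
    · rw [h] at hadj; exact hna hadj
    · rw [h] at hadj; exact hnb hadj
  · intro hpiv
    have := hpiv.2 s hsS
    rw [hE] at this
    rcases this with h | h
    · exact hsp (p.snd_mem_support_of_mem_edges h)
    · exact hxq (q.fst_mem_support_of_mem_edges h)

lemma no_common {W : Type} {G : SimpleGraph W} {a b c : W} {p q : G.Walk a b} (hp : p.IsPath)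
    (lp : 3 ≤ p.length) (hd : ∀ w, w ∈ p.support → w ∈ q.support → w = a ∨ w = b)
    (hc : c ∈ p.support)
    (h1 : s(c, a) ∈ p.edges ∨ s(c, a) ∈ q.edges) (h2 : s(c, b) ∈ p.edges ∨ s(c, b) ∈ q.edges) :
    False := by
  have hca : c ≠ a := by
    rintro rfl
    rcases h1 with h | h
    · exact (p.adj_of_mem_edges h).ne rfl
    · exact (q.adj_of_mem_edges h).ne rfl
  have hcb : c ≠ b := by
    rintro rfl
    rcases h2 with h | h
    · exact (p.adj_of_mem_edges h).ne rfl
    · exact (q.adj_of_mem_edges h).ne rfl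
  have hcq : c ∉ q.support := fun h => by
    rcases hd c hc h with h | h
    · exact hca h
    · exact hcb h
  have e1 : s(a, c) ∈ p.edges := by
    rw [Sym2.eq_swap]
    rcases h1 with h | h
    · exact h
    · exact absurd (q.fst_mem_support_of_mem_edges h) hcq
  have e2 : s(b, c) ∈ p.edges := by
    rw [Sym2.eq_swap]
    rcases h2 with h | h
    · exact h
    · exact absurd (q.fst_mem_support_of_mem_edges h) hcq
  have e3 := hp.eq_snd_of_mem_edges e1
  have e4 := hp.eq_penultimate_of_mem_edges e2
  have := hp.getVert_injOn (by simp only [Set.mem_ofPred_eq]; omega : 1 ∈ {i | i ≤ p.length})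
    (by simp only [Set.mem_ofPred_eq]; omega : p.length - 1 ∈ {i | i ≤ p.length}) (e3.symm.trans e4)
  omega

lemma core {W : Type} {G : SimpleGraph W} {A : W → W → Prop} (hB : IsOrientedBurling G A)
    {a b : W} {p q r : G.Walk a b} (hq : q.IsPath) (hr : r.IsPath)
    (lq : 3 ≤ q.length) (lr : 3 ≤ r.length)
    (hpq : IsHole G (p.append q.reverse)) (hpr : IsHole G (p.append r.reverse))
    (hqr : IsHole G (q.append r.reverse))
    (dpq : ∀ w, w ∈ p.support → w ∈ q.support → w = a ∨ w = b)
    (dpr : ∀ w, w ∈ p.support → w ∈ r.support → w = a ∨ w = b)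
    (dqr : ∀ w, w ∈ q.support → w ∈ r.support → w = a ∨ w = b)
    {x : W} (hx : x ∈ p.support) (hxa : x ≠ a) (hxb : x ≠ b) (hna : ¬ G.Adj a x)
    (hnb : ¬ G.Adj b x) : ∃ (w₀ : W) (c : G.Walk w₀ w₀), IsHole G c ∧ IsHoleSubordinate A c x := by
  obtain ⟨c, s, y, hsy, h1, h2, hs, hy, -⟩ := hole_fact hB _ hqr
  have hE : ∀ e, e ∈ (q.append r.reverse).edges ↔ e ∈ q.edges ∨ e ∈ r.edges := by
    intro e; simp
  have main : ∀ s, IsHoleSource A (q.append r.reverse) s → s ≠ a → s ≠ b →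
      ∃ (w₀ : W) (c : G.Walk w₀ w₀), IsHole G c ∧ IsHoleSubordinate A c x := by
    intro s hs hsa hsb
    have hm := hs.1
    simp only [Walk.mem_support_append_iff, Walk.support_reverse, List.mem_reverse] at hm
    rcases hm with hm | hm
    · exact ⟨_, _, hpq, core_aux hB hpq dpq hx hxa hxb hna hnb hm hsa hsb
        (fun z hz => hs.2 z ((hE _).2 (Or.inl hz)))⟩
    · exact ⟨_, _, hpr, core_aux hB hpr dpr hx hxa hxb hna hnb hm hsa hsb
        (fun z hz => hs.2 z ((hE _).2 (Or.inr hz)))⟩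
  have hab : ¬ (s(c, a) ∈ (q.append r.reverse).edges ∧ s(c, b) ∈ (q.append r.reverse).edges) := by
    rintro ⟨e1, e2⟩
    have hc := Walk.fst_mem_support_of_mem_edges _ e1
    simp only [Walk.mem_support_append_iff, Walk.support_reverse, List.mem_reverse] at hc
    rw [hE] at e1 e2
    rcases hc with hc | hc
    · exact no_common hq lq dqr hc e1 e2
    · exact no_common hr lr (fun w h1 h2 => dqr w h2 h1) hc e1.symm e2.symm
  by_cases hs0 : s ≠ a ∧ s ≠ b
  · exact main s hs hs0.1 hs0.2
  by_cases hy0 : y ≠ a ∧ y ≠ b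
  · exact main y hy hy0.1 hy0.2
  exfalso
  have hs1 : s = a ∨ s = b := by tauto
  have hy1 : y = a ∨ y = b := by tauto
  rcases hs1 with rfl | rfl <;> rcases hy1 with rfl | rfl
  · exact hsy rfl
  · exact hab ⟨h1, h2⟩
  · exact hab ⟨h2, h1⟩
  · exact hsy rfl

section
variable {V W : Type} {G' : SimpleGraph W} {G : SimpleGraph V} {f : V ↪ W}
    {P : ∀ ⦃u v : V⦄, G.Adj u v → G'.Walk (f u) (f v)}

/-- paths of a theta are induced -/
lemma theta_chordless {u v : V} {P₁ P₂ P₃ : G.Walk u v}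
    (h₂ : P₂.IsPath) (h₃ : P₃.IsPath) (l₂ : 3 ≤ P₂.length) (l₃ : 3 ≤ P₃.length)
    (d₁₂ : ∀ w, w ∈ P₁.support → w ∈ P₂.support → w = u ∨ w = v)
    (d₁₃ : ∀ w, w ∈ P₁.support → w ∈ P₃.support → w = u ∨ w = v)
    (hcovE : ∀ p q, G.Adj p q → s(p, q) ∈ P₁.edges ∨ s(p, q) ∈ P₂.edges ∨ s(p, q) ∈ P₃.edges) :
    ∀ x y, x ∈ P₁.support → y ∈ P₁.support → G.Adj x y → s(x, y) ∈ P₁.edges := by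
  have aux : ∀ Q : G.Walk u v, Q.IsPath → 3 ≤ Q.length →
      (∀ w, w ∈ P₁.support → w ∈ Q.support → w = u ∨ w = v) → ∀ x y, x ∈ P₁.support →
      y ∈ P₁.support → G.Adj x y → s(x, y) ∈ Q.edges → False := by
    intro Q hQ lQ dQ x y hx hy hxy he
    have h1 := dQ x hx (Q.fst_mem_support_of_mem_edges he)
    have h2 := dQ y hy (Q.snd_mem_support_of_mem_edges he)
    have h3 : s(u, v) ∈ Q.edges := by
      rcases h1 with rfl | rfl <;> rcases h2 with rfl | rfl
      · exact absurd rfl hxy.ne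
      · exact he
      · rw [Sym2.eq_swap]; exact he
      · exact absurd rfl hxy.ne
    have := hQ.length_eq_one_of_mem_edges h3
    omega
  intro x y hx hy hxy
  rcases hcovE x y hxy with h | h | h
  · exact h
  · exact (aux P₂ h₂ l₂ d₁₂ x y hx hy hxy h).elim
  · exact (aux P₃ h₃ l₃ d₁₃ x y hx hy hxy h).elim

lemma theta_disj (hS : IsSubdivisionVia G' G f P) {u v : V} {P₁ P₂ : G.Walk u v}
    {Q₁ Q₂ : G'.Walk (f u) (f v)} (h₁ : P₁.IsPath) (l₁ : 3 ≤ P₁.length)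
    (d₁₂ : ∀ w, w ∈ P₁.support → w ∈ P₂.support → w = u ∨ w = v)
    (c₁ : ∀ w ∈ Q₁.support, w = f v ∨ ∃ e ∈ P₁.edges, w ∈ gad P e)
    (c₂ : ∀ w ∈ Q₂.support, w = f v ∨ ∃ e ∈ P₂.edges, w ∈ gad P e) :
    ∀ w, w ∈ Q₁.support → w ∈ Q₂.support → w = f u ∨ w = f v := by
  intro w hw1 hw2
  rcases c₁ w hw1 with rfl | ⟨e, he, hwe⟩
  · exact Or.inr rfl
  have hne : e ∉ P₂.edges := by
    intro he2
    induction e with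
    | _ x y =>
    have hxy := P₁.adj_of_mem_edges he
    have h1 := d₁₂ x (P₁.fst_mem_support_of_mem_edges he) (P₂.fst_mem_support_of_mem_edges he2)
    have h2 := d₁₂ y (P₁.snd_mem_support_of_mem_edges he) (P₂.snd_mem_support_of_mem_edges he2)
    have h3 : s(u, v) ∈ P₁.edges := by
      rcases h1 with rfl | rfl <;> rcases h2 with rfl | rfl
      · exact absurd rfl hxy.ne
      · exact he
      · rw [Sym2.eq_swap]; exact he
      · exact absurd rfl hxy.ne
    have := h₁.length_eq_one_of_mem_edges h3
    omega
  obtain ⟨z, rfl, hz1, hz2⟩ := gad_of_cover hS (c₂ w hw2) hwe hne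
  rcases d₁₂ z (Walk.mem_support_of_mem_edges he hz1) hz2 with rfl | rfl
  · exact Or.inl rfl
  · exact Or.inr rfl

lemma theta_cross (hS : IsSubdivisionVia G' G f P) {u v : V} {P₁ P₂ P₃ : G.Walk u v}
    {Q₁ Q₂ Q₃ : G'.Walk (f u) (f v)}
    (d₁₂ : ∀ w, w ∈ P₁.support → w ∈ P₂.support → w = u ∨ w = v)
    (hcovE : ∀ p q, G.Adj p q → s(p, q) ∈ P₁.edges ∨ s(p, q) ∈ P₂.edges ∨ s(p, q) ∈ P₃.edges)
    (h₁ : P₁.IsPath) (l₁ : 3 ≤ P₁.length) (h₂ : P₂.IsPath) (l₂ : 3 ≤ P₂.length)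
    (h₃ : P₃.IsPath) (l₃ : 3 ≤ P₃.length)
    (d₁₃ : ∀ w, w ∈ P₁.support → w ∈ P₃.support → w = u ∨ w = v)
    (d₂₃ : ∀ w, w ∈ P₂.support → w ∈ P₃.support → w = u ∨ w = v)
    (c₁ : ∀ w ∈ Q₁.support, w = f v ∨ ∃ e ∈ P₁.edges, w ∈ gad P e)
    (c₂ : ∀ w ∈ Q₂.support, w = f v ∨ ∃ e ∈ P₂.edges, w ∈ gad P e)
    (k₁ : ∀ x y, x ∈ Q₁.support → y ∈ Q₁.support → G'.Adj x y → s(x, y) ∈ Q₁.edges)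
    (k₂ : ∀ x y, x ∈ Q₂.support → y ∈ Q₂.support → G'.Adj x y → s(x, y) ∈ Q₂.edges) :
    ∀ x y, (x ∈ Q₁.support ∨ x ∈ Q₂.support) → (y ∈ Q₁.support ∨ y ∈ Q₂.support) → G'.Adj x y →
      s(x, y) ∈ Q₁.edges ∨ s(x, y) ∈ Q₂.edges := by
  have nouv : ∀ (R R' : G.Walk u v), R.IsPath → 3 ≤ R.length →
      (∀ w, w ∈ R.support → w ∈ R'.support → w = u ∨ w = v) →
      ∀ x y, s(x, y) ∈ R.edges → s(x, y) ∈ R'.edges → False := by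
    intro R R' hR lR d x y he he2
    have hxy := R.adj_of_mem_edges he
    have h1 := d x (R.fst_mem_support_of_mem_edges he) (R'.fst_mem_support_of_mem_edges he2)
    have h2 := d y (R.snd_mem_support_of_mem_edges he) (R'.snd_mem_support_of_mem_edges he2)
    have h3 : s(u, v) ∈ R.edges := by
      rcases h1 with rfl | rfl <;> rcases h2 with rfl | rfl
      · exact absurd rfl hxy.ne
      · exact he
      · rw [Sym2.eq_swap]; exact he
      · exact absurd rfl hxy.ne
    have := hR.length_eq_one_of_mem_edges h3
    omega
  -- if a vertex of a path lies in a gadget of another path it is an apex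
  have apex : ∀ (R R' : G.Walk u v) (Q : G'.Walk (f u) (f v)), R'.IsPath → 3 ≤ R'.length →
      (∀ w, w ∈ R'.support → w ∈ R.support → w = u ∨ w = v) →
      (∀ w ∈ Q.support, w = f v ∨ ∃ e ∈ R.edges, w ∈ gad P e) →
      ∀ w p q, w ∈ Q.support → s(p, q) ∈ R'.edges → w ∈ gad P s(p, q) → w = f u ∨ w = f v := by
    intro R R' Q hR' lR' d c w p q hw he hg
    obtain ⟨z, rfl, hz1, hz2⟩ := gad_of_cover hS (c w hw) hg (fun h => nouv R' R hR' lR' d p q he h)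
    rcases d z (Walk.mem_support_of_mem_edges he hz1) hz2 with rfl | rfl
    · exact Or.inl rfl
    · exact Or.inr rfl
  have memA : ∀ (Q : G'.Walk (f u) (f v)) w, (w = f u ∨ w = f v) → w ∈ Q.support := by
    rintro Q w (rfl | rfl)
    · exact Q.start_mem_support
    · exact Q.end_mem_support
  have cross : ∀ x y, x ∈ Q₁.support → y ∈ Q₂.support → G'.Adj x y →
      s(x, y) ∈ Q₁.edges ∨ s(x, y) ∈ Q₂.edges := by
    intro x y hx hy hxy
    obtain ⟨p, q, hpq, hxe, hye⟩ := gad_adj hS hxy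
    rcases hcovE p q hpq with h | h | h
    · exact Or.inl (k₁ x y hx (memA _ _ (apex P₂ P₁ Q₂ h₁ l₁ d₁₂ c₂ y p q hy h hye)) hxy)
    · exact Or.inr (k₂ x y (memA _ _ (apex P₁ P₂ Q₁ h₂ l₂ (fun w a b => d₁₂ w b a) c₁ x p q hx h hxe))
        hy hxy)
    · exact Or.inl (k₁ x y hx (memA _ _ (apex P₂ P₃ Q₂ h₃ l₃ (fun w a b => d₂₃ w b a) c₂ y p q hy h hye))
        hxy)
  intro x y hx hy hxy
  rcases hx with hx | hx <;> rcases hy with hy | hy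
  · exact Or.inl (k₁ x y hx hy hxy)
  · exact cross x y hx hy hxy
  · rw [Sym2.eq_swap]; exact cross y x hy hx hxy.symm
  · exact Or.inr (k₂ x y hx hy hxy)

end

lemma snd_facts {V : Type} {G : SimpleGraph V} {u v : V} {p : G.Walk u v} (hp : p.IsPath)
    (lp : 3 ≤ p.length) : p.snd ∈ p.support ∧ G.Adj u p.snd ∧ p.snd ≠ v := by
  have hn : ¬ p.Nil := by intro h; have := Walk.nil_iff_length_eq.1 h; omega
  refine ⟨p.getVert_mem_support 1, p.adj_snd hn, ?_⟩
  intro h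
  have : s(u, v) ∈ p.edges := by
    have h1 := p.mk_start_snd_mem_edges hn
    rwa [h] at h1
  have := hp.length_eq_one_of_mem_edges this
  omega

lemma apex_not_degTwo {V : Type} {G : SimpleGraph V} {u v : V} {P₁ P₂ P₃ : G.Walk u v}
    (h₁ : P₁.IsPath) (h₂ : P₂.IsPath) (h₃ : P₃.IsPath)
    (l₁ : 3 ≤ P₁.length) (l₂ : 3 ≤ P₂.length) (l₃ : 3 ≤ P₃.length)
    (d₁₂ : ∀ w, w ∈ P₁.support → w ∈ P₂.support → w = u ∨ w = v)
    (d₁₃ : ∀ w, w ∈ P₁.support → w ∈ P₃.support → w = u ∨ w = v)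
    (d₂₃ : ∀ w, w ∈ P₂.support → w ∈ P₃.support → w = u ∨ w = v) : ¬ DegTwo G u := by
  rintro ⟨p, q, hpq, hp, hq, hall⟩
  obtain ⟨m1, a1, n1⟩ := snd_facts h₁ l₁
  obtain ⟨m2, a2, n2⟩ := snd_facts h₂ l₂
  obtain ⟨m3, a3, n3⟩ := snd_facts h₃ l₃
  have e12 : P₁.snd ≠ P₂.snd := by
    intro h
    rcases d₁₂ _ m1 (h ▸ m2) with h' | h'
    · exact a1.ne h'.symm
    · exact n1 h'
  have e13 : P₁.snd ≠ P₃.snd := by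
    intro h
    rcases d₁₃ _ m1 (h ▸ m3) with h' | h'
    · exact a1.ne h'.symm
    · exact n1 h'
  have e23 : P₂.snd ≠ P₃.snd := by
    intro h
    rcases d₂₃ _ m2 (h ▸ m3) with h' | h'
    · exact a2.ne h'.symm
    · exact n2 h'
  have b1 := hall _ a1
  have b2 := hall _ a2
  have b3 := hall _ a3
  grind

lemma main_aux (V : Type) (G : SimpleGraph V) (u v : V)
    (P₁ P₂ P₃ : G.Walk u v)
    (h₁ : P₁.IsPath) (h₂ : P₂.IsPath) (h₃ : P₃.IsPath)
    (l₁ : 3 ≤ P₁.length) (l₂ : 3 ≤ P₂.length) (l₃ : 3 ≤ P₃.length)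
    (d₁₂ : ∀ w, w ∈ P₁.support → w ∈ P₂.support → w = u ∨ w = v)
    (d₁₃ : ∀ w, w ∈ P₁.support → w ∈ P₃.support → w = u ∨ w = v)
    (d₂₃ : ∀ w, w ∈ P₂.support → w ∈ P₃.support → w = u ∨ w = v)
    (hcovE : ∀ p q, G.Adj p q → s(p, q) ∈ P₁.edges ∨ s(p, q) ∈ P₂.edges ∨ s(p, q) ∈ P₃.edges)
    (x : V) (hx : DegTwo G x) (hxn : ∀ y, G.Adj x y → DegTwo G y) (hx1 : x ∈ P₁.support)
    (W : Type) (G' : SimpleGraph W) (f : V ↪ W)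
    (P : ∀ ⦃p q : V⦄, G.Adj p q → G'.Walk (f p) (f q))
    (hS : IsSubdivisionVia G' G f P) (A : W → W → Prop) (hB : IsOrientedBurling G' A) :
        ∃ (w₀ : W) (c : G'.Walk w₀ w₀), IsHole G' c ∧ IsHoleSubordinate A c (f x) := by
  have r21 := fun w a b => d₁₂ w b a
  have r31 := fun w a b => d₁₃ w b a
  have r32 := fun w a b => d₂₃ w b a
  have hu : ¬ DegTwo G u := apex_not_degTwo h₁ h₂ h₃ l₁ l₂ l₃ d₁₂ d₁₃ d₂₃
  have hv : ¬ DegTwo G v := by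
    refine apex_not_degTwo (P₁ := P₁.reverse) (P₂ := P₂.reverse) (P₃ := P₃.reverse)
      h₁.reverse h₂.reverse h₃.reverse (by simpa using l₁) (by simpa using l₂)
      (by simpa using l₃) ?_ ?_ ?_
    · intro w a b; simp at a b; exact (d₁₂ w a b).symm
    · intro w a b; simp at a b; exact (d₁₃ w a b).symm
    · intro w a b; simp at a b; exact (d₂₃ w a b).symm
  have hxu : x ≠ u := by rintro rfl; exact hu hx
  have hxv : x ≠ v := by rintro rfl; exact hv hx
  have hnadj : ∀ z, ¬ DegTwo G z → x ≠ z → ¬ G'.Adj (f z) (f x) := by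
    intro z hz hxz h
    obtain ⟨p, q, hpq, h1, h2⟩ := gad_adj hS h
    have e := mem_pair_of (gad_mem hS h2) (gad_mem hS h1) hxz
    apply hz
    apply hxn
    rw [← SimpleGraph.mem_edgeSet, ← e]
    exact hpq
  obtain ⟨Q₁, q₁, m₁, s₁, c₁, k₁⟩ := build hS P₁ h₁
    (theta_chordless h₂ h₃ l₂ l₃ d₁₂ d₁₃ hcovE)
  obtain ⟨Q₂, q₂, m₂, s₂, c₂, k₂⟩ := build hS P₂ h₂
    (theta_chordless h₁ h₃ l₁ l₃ r21 d₂₃ (fun p q h => by have := hcovE p q h; tauto))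
  obtain ⟨Q₃, q₃, m₃, s₃, c₃, k₃⟩ := build hS P₃ h₃
    (theta_chordless h₁ h₂ l₁ l₂ r31 r32 (fun p q h => by have := hcovE p q h; tauto))
  have D₁₂ := theta_disj hS h₁ l₁ d₁₂ c₁ c₂
  have D₁₃ := theta_disj hS h₁ l₁ d₁₃ c₁ c₃
  have D₂₃ := theta_disj hS h₂ l₂ d₂₃ c₂ c₃
  have H₁₂ := hole_of_paths q₁ q₂ (by omega) (by omega) D₁₂
    (theta_cross (Q₃ := Q₃) hS d₁₂ hcovE h₁ l₁ h₂ l₂ h₃ l₃ d₁₃ d₂₃ c₁ c₂ k₁ k₂)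
  have H₁₃ := hole_of_paths q₁ q₃ (by omega) (by omega) D₁₃
    (theta_cross (Q₃ := Q₂) hS d₁₃ (fun p q h => by have := hcovE p q h; tauto)
      h₁ l₁ h₃ l₃ h₂ l₂ d₁₂ r32 c₁ c₃ k₁ k₃)
  have H₂₃ := hole_of_paths q₂ q₃ (by omega) (by omega) D₂₃
    (theta_cross (Q₃ := Q₁) hS d₂₃ (fun p q h => by have := hcovE p q h; tauto)
      h₂ l₂ h₃ l₃ h₁ l₁ r21 r31 c₂ c₃ k₂ k₃)
  exact core hB q₂ q₃ (by omega) (by omega) H₁₂ H₁₃ H₂₃ D₁₂ D₁₃ D₂₃ (s₁ x hx1)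
    (fun h => hxu (f.injective h)) (fun h => hxv (f.injective h)) (hnadj u hu hxu) (hnadj v hv hxv)

/-- in a long theta, a degree-2 vertex whose two neighbours also have degree 2
is a global subordinate vertex of every subdivision: in every orientation of any subdivision
as an oriented Burling graph, it is subordinate in some hole. -/
theorem longTheta_globalSubordinate (V : Type) (G : SimpleGraph V) (u v : V) (huv : u ≠ v)
    (P₁ P₂ P₃ : G.Walk u v)
    (h₁ : P₁.IsPath) (h₂ : P₂.IsPath) (h₃ : P₃.IsPath)
    (l₁ : 3 ≤ P₁.length) (l₂ : 3 ≤ P₂.length) (l₃ : 3 ≤ P₃.length)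
    (d₁₂ : ∀ w, w ∈ P₁.support → w ∈ P₂.support → w = u ∨ w = v)
    (d₁₃ : ∀ w, w ∈ P₁.support → w ∈ P₃.support → w = u ∨ w = v)
    (d₂₃ : ∀ w, w ∈ P₂.support → w ∈ P₃.support → w = u ∨ w = v)
    (hcovV : ∀ w, w ∈ P₁.support ∨ w ∈ P₂.support ∨ w ∈ P₃.support)
    (hcovE : ∀ p q, G.Adj p q → s(p, q) ∈ P₁.edges ∨ s(p, q) ∈ P₂.edges ∨ s(p, q) ∈ P₃.edges)
    (x : V) (hx : DegTwo G x) (hxn : ∀ y, G.Adj x y → DegTwo G y) :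
    ∀ (W : Type) (G' : SimpleGraph W) (f : V ↪ W)
      (P : ∀ ⦃p q : V⦄, G.Adj p q → G'.Walk (f p) (f q)),
      IsSubdivisionVia G' G f P → ∀ A, IsOrientedBurling G' A →
        ∃ (w₀ : W) (c : G'.Walk w₀ w₀), IsHole G' c ∧ IsHoleSubordinate A c (f x) := by
  intro W G' f P hS A hB
  have r21 := fun w a b => d₁₂ w b a
  have r31 := fun w a b => d₁₃ w b a
  have r32 := fun w a b => d₂₃ w b a
  rcases hcovV x with h | h | h
  · exact main_aux V G u v P₁ P₂ P₃ h₁ h₂ h₃ l₁ l₂ l₃ d₁₂ d₁₃ d₂₃ hcovE x hx hxn h W G' f P hS A hB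
  · exact main_aux V G u v P₂ P₁ P₃ h₂ h₁ h₃ l₂ l₁ l₃ r21 d₂₃ d₁₃
      (fun p q h => by have := hcovE p q h; tauto) x hx hxn h W G' f P hS A hB
  · exact main_aux V G u v P₃ P₁ P₂ h₃ h₁ h₂ l₃ l₁ l₂ r31 r32 d₁₂
      (fun p q h => by have := hcovE p q h; tauto) x hx hxn h W G' f P hS A hB

end BurlingFormal
end

section
/- Let G be the graph obtained by gluing two Burling-admissible type-2 subdivisions of K_4 along a common edge xy: explicitly, G has degree-4 vertices x, y and two 'side' configurations so that G contains two induced subdivisions of K_4, H_l with branch vertices {u, x, y, z} and H_r with branch vertices {v, x, y, w}, sharing exactly the edge xy. Then no subdivision of G admits an orientation that simultaneously makes both H_l and H_r oriented Burling graphs; hence no subdivision of G is a Burling graph. -/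
namespace BurlingFormal

open SimpleGraph

section Tree
variable {V : Type} (T : BurlingTree V)

/-- `Desc T a b`: `b` is a descendant of `a`. -/
def Desc (a b : V) : Prop := ∃ n, T.parent^[n] b = a

open Classical in
/-- depth in the tree -/
noncomputable def dep (v : V) : ℕ := Nat.find (T.reach v)

variable {T}

lemma dep_root : dep T T.root = 0 := by
  classical
  unfold dep; rw [Nat.find_eq_zero]; rfl

lemma dep_parent {v : V} (h : v ≠ T.root) : dep T v = dep T (T.parent v) + 1 := by
  classical
  unfold dep
  rw [Nat.find_eq_iff]
  constructor
  · have := Nat.find_spec (T.reach (T.parent v))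
    simpa [Function.iterate_succ_apply] using this
  · intro n hn
    cases n with
    | zero => simpa using h
    | succ k =>
      have := Nat.find_min (T.reach (T.parent v)) (m := k) (by omega)
      simpa [Function.iterate_succ_apply] using this

lemma parent_ne {v : V} (h : v ≠ T.root) : T.parent v ≠ v := by
  intro h'
  have := dep_parent h
  rw [h'] at this
  omega

lemma Desc.refl (a : V) : Desc T a a := ⟨0, rfl⟩

lemma Desc.parent (a : V) : Desc T (T.parent a) a := ⟨1, rfl⟩

lemma Desc.trans {a b c : V} (h : Desc T a b) (h' : Desc T b c) : Desc T a c := by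
  obtain ⟨n, rfl⟩ := h
  obtain ⟨m, rfl⟩ := h'
  exact ⟨n + m, by rw [Function.iterate_add_apply]⟩

lemma Desc.cases {a b : V} (h : Desc T a b) : a = b ∨ Desc T a (T.parent b) := by
  obtain ⟨n, hn⟩ := h
  cases n with
  | zero => left; exact hn.symm
  | succ k => right; exact ⟨k, by simpa [Function.iterate_succ_apply] using hn⟩

lemma Desc.dep {a b : V} (h : Desc T a b) : a = b ∨ dep T a < dep T b := by
  obtain ⟨n, hn⟩ := h
  induction n generalizing b with
  | zero => left; exact hn.symm
  | succ k ih =>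
    by_cases hb : b = T.root
    · left
      rw [← hn, hb, Function.iterate_fixed T.parent_root]
    · right
      rw [Function.iterate_succ_apply] at hn
      have := dep_parent hb
      rcases ih hn with h | h
      · rw [h]; omega
      · omega

lemma Desc.antisymm {a b : V} (h : Desc T a b) (h' : Desc T b a) : a = b := by
  rcases h.dep with h | h
  · exact h
  · rcases h'.dep with h1 | h1
    · exact h1.symm
    · omega

lemma Desc.total {a b c : V} (h : Desc T a c) (h' : Desc T b c) : Desc T a b ∨ Desc T b a := by
  obtain ⟨n, rfl⟩ := h
  obtain ⟨m, rfl⟩ := h'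
  rcases le_total n m with h | h
  · right
    exact ⟨m - n, by rw [← Function.iterate_add_apply]; congr 1; omega⟩
  · left
    exact ⟨n - m, by rw [← Function.iterate_add_apply]; congr 1; omega⟩

lemma arc_basic {u v : V} (h : T.Arc u v) : ∃ l, u ≠ T.root ∧ u ≠ l ∧ l = T.lastBorn (T.parent u) ∧
    T.parent l = T.parent u ∧ l ≠ T.root ∧ l ∈ T.choosePath u ∧
    (∀ w ∈ T.choosePath u, w ≠ l → T.parent w ∈ T.choosePath u ∧ T.parent w ≠ w) ∧
    (∀ w ∈ T.choosePath u, ∀ w' ∈ T.choosePath u, w ≠ l → w' ≠ l →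
      T.parent w = T.parent w' → w = w') := by
  unfold BurlingTree.Arc at h
  have hu : ¬ (u = T.root ∨ u = T.lastBorn (T.parent u)) := by
    intro h'
    rw [T.choosePath_empty u h'] at h
    exact h
  push Not at hu
  have hl := T.lastBorn_child (T.parent u) ⟨u, (parent_ne hu.1).symm, rfl⟩
  rcases T.choosePath_branch u hu.1 hu.2 with h0 | h0
  · rw [h0] at h; exact h.elim
  · refine ⟨_, hu.1, hu.2, rfl, hl.1, ?_, h0.1, h0.2.1, h0.2.2⟩
    intro hr
    have h1 := hl.1
    rw [hr, T.parent_root] at h1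
    exact hl.2 (hr.trans h1)

lemma arc_desc {u v : V} (h : T.Arc u v) : Desc T (T.lastBorn (T.parent u)) v := by
  obtain ⟨l, h1, h2, h3, h4, h5, h6, h7, h8⟩ := arc_basic h
  rw [← h3]
  have : ∀ n v, dep T v = n → v ∈ T.choosePath u → Desc T l v := by
    intro n
    induction n with
    | zero =>
      intro v hv hvS
      by_cases hvl : v = l
      · rw [hvl]; exact Desc.refl _
      · have := (h7 v hvS hvl).2
        by_cases hr : v = T.root
        · rw [hr, T.parent_root] at this; exact (this rfl).elim
        · have := dep_parent hr; omega
    | succ k ih =>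
      intro v hv hvS
      by_cases hvl : v = l
      · rw [hvl]; exact Desc.refl _
      · have h9 := (h7 v hvS hvl)
        by_cases hr : v = T.root
        · rw [hr, T.parent_root] at h9; exact (h9.2 rfl).elim
        · have := dep_parent hr
          exact (ih _ (by omega) h9.1).trans (Desc.parent v)
  exact this _ v rfl h

lemma arc_down {u v a : V} (h : T.Arc u v) (ha : Desc T (T.lastBorn (T.parent u)) a)
    (hv : Desc T a v) : T.Arc u a := by
  obtain ⟨l, h1, h2, h3, h4, h5, h6, h7, h8⟩ := arc_basic h
  rw [← h3] at ha
  obtain ⟨n, hn⟩ := hv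
  induction n generalizing v with
  | zero => rw [← hn]; exact h
  | succ k ih =>
    by_cases hvl : v = l
    · have h9 : Desc T a v := ⟨_, hn⟩
      rw [hvl] at h9
      rw [ha.antisymm h9] at h6
      exact h6
    · exact ih (h7 v h hvl).1 (by simpa [Function.iterate_succ_apply] using hn)

lemma arc_chain {u v w : V} (h : T.Arc u v) (h' : T.Arc u w) : Desc T v w ∨ Desc T w v := by
  obtain ⟨l, h1, h2, h3, h4, h5, h6, h7, h8⟩ := arc_basic h
  have hd : ∀ v, T.Arc u v → Desc T l v := fun v h => h3 ▸ arc_desc h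
  have key : ∀ n v w, T.Arc u v → T.Arc u w → dep T w = n → dep T v ≤ dep T w → Desc T v w := by
    intro n
    induction n with
    | zero =>
      intro v w hv hw hn hle
      have a1 := (hd v hv).dep
      have a2 := (hd w hw).dep
      have : v = w := by
        rcases a1 with a1 | a1
        · rcases a2 with a2 | a2
          · rw [← a1, ← a2]
          · omega
        · omega
      rw [this]; exact Desc.refl _
    | succ k ih =>
      intro v w hv hw hn hle
      have a1 := (hd v hv).dep
      have a2 := (hd w hw).dep
      by_cases hwl : w = l
      · rcases a1 with a1 | a1
        · rw [hwl, a1]; exact Desc.refl _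
        · rw [hwl] at hle; omega
      have hwr : w ≠ T.root := by
        intro h; rw [h, dep_root] at hn; omega
      have b1 := dep_parent hwr
      have b2 := h7 w hw hwl
      by_cases hvl : v = l
      · rw [hvl]; exact hd w hw
      rcases Nat.lt_or_ge (dep T v) (dep T w) with hlt | hge
      · exact (ih v (T.parent w) hv b2.1 (by omega) (by omega)).trans (Desc.parent w)
      · have hvr : v ≠ T.root := by
          intro h; rw [h, dep_root] at hge; omega
        have c1 := dep_parent hvr
        have c2 := h7 v hv hvl
        have c3 := ih _ _ c2.1 b2.1 (by omega) (by omega)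
        have c4 := c3.dep
        have : T.parent v = T.parent w := by
          rcases c4 with c4 | c4
          · exact c4
          · omega
        rw [h8 v hv w hw hvl hwl this]; exact Desc.refl _
  rcases le_total (dep T v) (dep T w) with hh | hh
  · left; exact key _ v w h h' rfl hh
  · right; exact key _ w v h' h rfl hh

lemma sib_incomp {u l : V} (hu : u ≠ T.root) (hul : u ≠ l)
    (hp : T.parent l = T.parent u) : ¬ Desc T u l := by
  intro h
  rcases h.cases with h | h
  · exact hul h
  · rw [hp] at h
    exact parent_ne hu ((Desc.parent u).antisymm h)

lemma arc_incomp {u v : V} (h : T.Arc u v) : ¬ Desc T u v ∧ ¬ Desc T v u := by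
  obtain ⟨l, h1, h2, h3, h4, h5, h6, h7, h8⟩ := arc_basic h
  have hd := arc_desc h
  rw [← h3] at hd
  have i1 := sib_incomp h1 h2 h4
  have i2 := sib_incomp h5 (Ne.symm h2) h4.symm
  constructor
  · intro h
    rcases h.total hd with h | h
    · exact i1 h
    · exact i2 h
  · intro h
    exact i2 (hd.trans h)

open Classical in
/-- measure increasing along arcs -/
noncomputable def mu (T : BurlingTree V) (v : V) : ℕ :=
  2 * dep T v + if v = T.lastBorn (T.parent v) then 1 else 0

lemma arc_mu {u v : V} (h : T.Arc u v) : mu T u < mu T v := by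
  obtain ⟨l, h1, h2, h3, h4, h5, h6, h7, h8⟩ := arc_basic h
  have hd := arc_desc h
  rw [← h3] at hd
  have e1 := dep_parent h1
  have e2 := dep_parent h5
  rw [h4] at e2
  have hu : ¬ (u = T.lastBorn (T.parent u)) := by rw [← h3]; exact h2
  unfold mu
  rw [if_neg hu]
  rcases hd.dep with hd | hd
  · rw [← hd, if_pos (by rw [h4]; exact h3)]
    omega
  · omega

/-- strict descendant -/
def SDesc (T : BurlingTree V) (a b : V) : Prop := Desc T a b ∧ a ≠ b

lemma sep_in {b p q : V} (hp : SDesc T b p) (h : T.Arc q p) : SDesc T b q ∨ T.Arc q b := by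
  obtain ⟨l, h1, h2, h3, h4, h5, h6, h7, h8⟩ := arc_basic h
  have hd := arc_desc h
  rcases hd.total hp.1 with h9 | h9
  · right; exact arc_down h h9 hp.1
  · rw [← h3] at h9
    rcases h9.cases with h9 | h9
    · right; rw [h9]; exact h6
    · left
      rw [h4] at h9
      refine ⟨h9.trans (Desc.parent q), ?_⟩
      rintro rfl
      exact parent_ne h1 ((Desc.parent b).antisymm h9)

lemma sep_out {b p q : V} (hp : SDesc T b p) (h : T.Arc p q) : SDesc T b q := by
  obtain ⟨l, h1, h2, h3, h4, h5, h6, h7, h8⟩ := arc_basic h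
  have hd := arc_desc h
  rw [← h3] at hd
  rcases hp.1.cases with h9 | h9
  · exact (hp.2 h9).elim
  · rw [← h4] at h9
    refine ⟨(h9.trans (Desc.parent l)).trans hd, ?_⟩
    rintro rfl
    exact parent_ne h5 ((Desc.parent l).antisymm (hd.trans h9))

end Tree

section Seg
variable {W : Type} (K : SimpleGraph W)

/-- `S` is the vertex set of an induced path from `u` to `v`. -/
def Seg (S : Set W) (u v : W) : Prop :=
  ∃ (n : ℕ) (p : ℕ → W), 1 ≤ n ∧ p 0 = u ∧ p n = v ∧ (∀ w, w ∈ S ↔ ∃ i ≤ n, p i = w) ∧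
    (∀ i j, i < j → j ≤ n → p i ≠ p j) ∧
    (∀ i, i < n → K.Adj (p i) (p (i+1))) ∧
    (∀ i j, i < j → j ≤ n → K.Adj (p i) (p j) → j = i + 1)

variable {K}

lemma exists_seg {B : Set W} {u v : W} (hu : u ∈ B) (hv : v ∈ B) (huv : u ≠ v)
    (h : (K.induce B).Reachable ⟨u, hu⟩ ⟨v, hv⟩) : ∃ S ⊆ B, Seg K S u v := by
  obtain ⟨w, hw⟩ := h.exists_walk_length_eq_dist
  have hlen : 1 ≤ w.length := by
    rcases Nat.eq_zero_or_pos w.length with h0 | h0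
    · have := SimpleGraph.Walk.eq_of_length_eq_zero h0
      exact (huv (congrArg Subtype.val this)).elim
    · exact h0
  refine ⟨{a | ∃ i ≤ w.length, (w.getVert i).1 = a}, ?_, w.length, fun i => (w.getVert i).1,
    hlen, by simp, by simp, fun _ => Iff.rfl, ?_, ?_, ?_⟩
  · rintro a ⟨i, -, rfl⟩
    exact (w.getVert i).2
  · intro i j hij hj heq
    have heq' : w.getVert i = w.getVert j := Subtype.ext heq
    have := SimpleGraph.dist_le ((w.take i).append ((w.drop j).copy heq'.symm rfl))
    rw [SimpleGraph.Walk.length_append, SimpleGraph.Walk.length_copy,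
      SimpleGraph.Walk.take_length, SimpleGraph.Walk.drop_length] at this
    omega
  · intro i hi
    exact w.adj_getVert_succ hi
  · intro i j hij hj hadj
    have hadj' : (K.induce B).Adj (w.getVert i) (w.getVert j) := hadj
    have := SimpleGraph.dist_le ((w.take i).append (SimpleGraph.Walk.cons hadj' (w.drop j)))
    rw [SimpleGraph.Walk.length_append, SimpleGraph.Walk.length_cons,
      SimpleGraph.Walk.take_length, SimpleGraph.Walk.drop_length] at this
    omega

lemma Seg.left_mem {S : Set W} {u v : W} (h : Seg K S u v) : u ∈ S := by
  obtain ⟨n, p, hn, h0, h1, hS, hinj, hadj, hch⟩ := h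
  exact (hS u).2 ⟨0, by omega, h0⟩

lemma Seg.right_mem {S : Set W} {u v : W} (h : Seg K S u v) : v ∈ S := by
  obtain ⟨n, p, hn, h0, h1, hS, hinj, hadj, hch⟩ := h
  exact (hS v).2 ⟨n, by omega, h1⟩

lemma Seg.nbr_left {S : Set W} {u v : W} (h : Seg K S u v) : ∃ a ∈ S, K.Adj u a := by
  obtain ⟨n, p, hn, h0, h1, hS, hinj, hadj, hch⟩ := h
  exact ⟨p 1, (hS _).2 ⟨1, by omega, rfl⟩, h0 ▸ hadj 0 (by omega)⟩

lemma Seg.nbr_right {S : Set W} {u v : W} (h : Seg K S u v) : ∃ a ∈ S, K.Adj v a := by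
  obtain ⟨n, p, hn, h0, h1, hS, hinj, hadj, hch⟩ := h
  refine ⟨p (n-1), (hS _).2 ⟨n-1, by omega, rfl⟩, ?_⟩
  have := hadj (n-1) (by omega)
  rw [show n - 1 + 1 = n by omega, h1] at this
  exact this.symm

lemma Seg.nbr_mid {S : Set W} {u v q : W} (h : Seg K S u v) (hq : q ∈ S) (hqu : q ≠ u)
    (hqv : q ≠ v) : ∃ a ∈ S, ∃ b ∈ S, a ≠ b ∧ K.Adj q a ∧ K.Adj q b := by
  obtain ⟨n, p, hn, h0, h1, hS, hinj, hadj, hch⟩ := h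
  obtain ⟨i, hi, rfl⟩ := (hS q).1 hq
  have hi0 : i ≠ 0 := by rintro rfl; exact hqu h0
  have hin : i ≠ n := by rintro rfl; exact hqv h1
  refine ⟨p (i-1), (hS _).2 ⟨i-1, by omega, rfl⟩, p (i+1), (hS _).2 ⟨i+1, by omega, rfl⟩,
    hinj _ _ (by omega) (by omega), ?_, hadj i (by omega)⟩
  have := hadj (i-1) (by omega)
  rw [show i - 1 + 1 = i by omega] at this
  exact this.symm

/-- if the part of the index range between i and j is untouched, D is constant on it -/
lemma path_const {n : ℕ} {p : ℕ → W} {N : Set W} {D : W → Prop}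
    (hadj : ∀ i, i < n → K.Adj (p i) (p (i+1)))
    (hD : ∀ i j, i ≤ n → j ≤ n → p i ∉ N → p j ∉ N → K.Adj (p i) (p j) → (D (p i) ↔ D (p j)))
    (i d : ℕ) (hd : i + d ≤ n) (hN : ∀ k, i ≤ k → k ≤ i + d → p k ∉ N) :
    D (p i) ↔ D (p (i + d)) := by
  induction d with
  | zero => simp
  | succ d ih =>
    rw [ih (by omega) (fun k h1 h2 => hN k h1 (by omega))]
    exact hD _ _ (by omega) (by omega) (hN _ (by omega) (by omega)) (hN _ (by omega) (by omega))
      (hadj _ (by omega))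

lemma Seg.alpha {S : Set W} {u v b q : W} (h : Seg K S u v) {N : Set W} {D : W → Prop}
    (hD : ∀ a ∈ S, ∀ c ∈ S, a ∉ N → c ∉ N → K.Adj a c → (D a ↔ D c))
    (hb : b ∈ S) (hbN : b ∈ N) (hN : ∀ a ∈ S, a ∈ N → a = b ∨ K.Adj a b)
    (hq : q ∈ S) (hqN : q ∉ N) : (u ∉ N ∧ (D q ↔ D u)) ∨ (v ∉ N ∧ (D q ↔ D v)) := by
  obtain ⟨n, p, hn, h0, h1, hS, hinj, hadj, hch⟩ := h
  have hm : ∀ i ≤ n, p i ∈ S := fun i hi => (hS _).2 ⟨i, hi, rfl⟩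
  have hD' : ∀ i j, i ≤ n → j ≤ n → p i ∉ N → p j ∉ N → K.Adj (p i) (p j) →
      (D (p i) ↔ D (p j)) := fun i j hi hj => hD _ (hm i hi) _ (hm j hj)
  obtain ⟨i, hi, rfl⟩ := (hS q).1 hq
  obtain ⟨k, hk, rfl⟩ := (hS b).1 hb
  have hnear : ∀ j ≤ n, p j ∈ N → j = k ∨ j = k + 1 ∨ k = j + 1 := by
    intro j hj hjN
    rcases lt_trichotomy j k with h | h | h
    · rcases hN _ (hm j hj) hjN with h' | h'
      · exact (hinj _ _ h hk h').elim
      · right; right; exact hch _ _ h hk h'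
    · exact Or.inl h
    · rcases hN _ (hm j hj) hjN with h' | h'
      · exact (hinj _ _ h hj h'.symm).elim
      · right; left; exact hch _ _ h hj h'.symm
  have hik : i ≠ k := by rintro rfl; exact hqN hbN
  rcases Nat.lt_or_ge i k with hlt | hge
  · left
    have hno : ∀ j, 0 ≤ j → j ≤ 0 + i → p j ∉ N := by
      intro j _ hj hjN
      have h3 := hnear j (by omega) hjN
      have : j = i := by omega
      rw [this] at hjN; exact hqN hjN
    have h2 := path_const hadj hD' 0 i (by omega) hno
    rw [← h0]
    refine ⟨hno 0 (by omega) (by omega), ?_⟩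
    rw [h2, Nat.zero_add]
  · right
    have hno : ∀ j, i ≤ j → j ≤ i + (n - i) → p j ∉ N := by
      intro j h5 hj hjN
      have h3 := hnear j (by omega) hjN
      have : j = i := by omega
      rw [this] at hjN; exact hqN hjN
    have h2 := path_const hadj hD' i (n-i) (by omega) hno
    rw [show i + (n-i) = n by omega] at h2 hno
    rw [← h1]
    exact ⟨hno n (by omega) (by omega), h2⟩

lemma Seg.beta {S : Set W} {u v q : W} (h : Seg K S u v) {N : Set W} {D : W → Prop}
    (hD : ∀ a ∈ S, ∀ c ∈ S, a ∉ N → c ∉ N → K.Adj a c → (D a ↔ D c))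
    (hN : ∀ a ∈ S, a ∈ N → a = u ∨ a = v)
    (hq : q ∈ S) (hqN : q ∉ N) : (u ∉ N → (D q ↔ D u)) ∧ (v ∉ N → (D q ↔ D v)) := by
  obtain ⟨n, p, hn, h0, h1, hS, hinj, hadj, hch⟩ := h
  have hm : ∀ i ≤ n, p i ∈ S := fun i hi => (hS _).2 ⟨i, hi, rfl⟩
  have hD' : ∀ i j, i ≤ n → j ≤ n → p i ∉ N → p j ∉ N → K.Adj (p i) (p j) →
      (D (p i) ↔ D (p j)) := fun i j hi hj => hD _ (hm i hi) _ (hm j hj)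
  obtain ⟨i, hi, rfl⟩ := (hS q).1 hq
  have hnear : ∀ j ≤ n, p j ∈ N → j = 0 ∨ j = n := by
    intro j hj hjN
    by_contra hcon
    push Not at hcon
    rcases hN _ (hm j hj) hjN with h' | h'
    · exact hinj 0 j (by omega) hj (h0.trans h'.symm)
    · exact hinj j n (by omega) (by omega) (h'.trans h1.symm)
  constructor
  · intro hu
    have hno : ∀ j, 0 ≤ j → j ≤ 0 + i → p j ∉ N := by
      intro j _ hj hjN
      rcases hnear j (by omega) hjN with h3 | h3
      · rw [h3, h0] at hjN; exact hu hjN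
      · have : j = i := by omega
        rw [this] at hjN; exact hqN hjN
    have h2 := path_const hadj hD' 0 i (by omega) hno
    rw [← h0, h2, Nat.zero_add]
  · intro hv
    have hno : ∀ j, i ≤ j → j ≤ i + (n - i) → p j ∉ N := by
      intro j h5 hj hjN
      rcases hnear j (by omega) hjN with h3 | h3
      · have : j = i := by omega
        rw [this] at hjN; exact hqN hjN
      · rw [h3, h1] at hjN; exact hv hjN
    have h2 := path_const hadj hD' i (n-i) (by omega) hno
    rw [show i + (n-i) = n by omega] at h2
    rw [← h1]; exact h2

end Seg

section Core
variable {W : Type}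

/-- first end of the edges of K4 -/
def ea : Fin 6 → Fin 4 := ![0, 0, 0, 1, 1, 2]
/-- second end of the edges of K4 -/
def eb : Fin 6 → Fin 4 := ![1, 2, 3, 2, 3, 3]

lemma e_ne (t : Fin 6) : ea t ≠ eb t := by revert t; decide

lemma e_ex (k m : Fin 4) (h : k ≠ m) :
    ∃ t, (ea t = k ∧ eb t = m) ∨ (ea t = m ∧ eb t = k) := by
  revert k m; decide

lemma e_uniq (s t : Fin 6) (h1 : ea s = ea t ∨ ea s = eb t) (h2 : eb s = ea t ∨ eb s = eb t) :
    s = t := by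
  revert s t; decide

/-- an induced subdivision of K4 -/
structure K4Sys (K : SimpleGraph W) (g : Fin 4 → W) (S : Fin 6 → Set W) : Prop where
  ginj : Function.Injective g
  seg : ∀ t, Seg K (S t) (g (ea t)) (g (eb t))
  branch : ∀ m t, g m ∈ S t → m = ea t ∨ m = eb t
  disj : ∀ s t a, s ≠ t → a ∈ S s → a ∈ S t → ∃ m, a = g m
  loc : ∀ a b s s', a ∈ S s → b ∈ S s' → K.Adj a b → ∃ t, a ∈ S t ∧ b ∈ S t
  nonadj : ∀ k l, K.Adj (g k) (g l) → (k = 0 ∧ (l = 1 ∨ l = 2)) ∨ (l = 0 ∧ (k = 1 ∨ k = 2))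

variable {K : SimpleGraph W} {g : Fin 4 → W} {S : Fin 6 → Set W}

lemma K4Sys.end_mem (h : K4Sys K g S) {m : Fin 4} {t : Fin 6} (hm : m = ea t ∨ m = eb t) :
    g m ∈ S t := by
  rcases hm with rfl | rfl
  · exact (h.seg t).left_mem
  · exact (h.seg t).right_mem

lemma K4Sys.const (h : K4Sys K g S) {b : W} {t₀ : Fin 6} (hb : b ∈ S t₀) {N : Set W}
    (hbN : b ∈ N) (hN : ∀ a ∈ N, (∃ s, a ∈ S s) ∧ (a = b ∨ K.Adj a b))
    (hex : ¬ (b = g 0 ∧ g 1 ∈ N)) {D : W → Prop}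
    (hD : ∀ a c, (∃ s, a ∈ S s) → (∃ s, c ∈ S s) → a ∉ N → c ∉ N → K.Adj a c → (D a ↔ D c))
    {p q : W} (hp : ∃ s, p ∈ S s) (hq : ∃ s, q ∈ S s) (hpN : p ∉ N) (hqN : q ∉ N) :
    D p ↔ D q := by
  have hDS : ∀ t, ∀ a ∈ S t, ∀ c ∈ S t, a ∉ N → c ∉ N → K.Adj a c → (D a ↔ D c) :=
    fun t a ha c hc => hD a c ⟨t, ha⟩ ⟨t, hc⟩
  -- segments not containing b are only touched at their ends
  have hends : ∀ t, b ∉ S t → ∀ a ∈ S t, a ∈ N → a = g (ea t) ∨ a = g (eb t) := by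
    intro t hbt a ha haN
    obtain ⟨-, hab⟩ := hN a haN
    rcases hab with rfl | hab
    · exact (hbt ha).elim
    · obtain ⟨s, has, hbs⟩ := h.loc a b t t₀ ha hb hab
      have hst : s ≠ t := by rintro rfl; exact hbt hbs
      obtain ⟨m, rfl⟩ := h.disj s t a hst has ha
      rcases h.branch m t ha with h1 | h1
      · left; rw [h1]
      · right; rw [h1]
  have hnb : ∀ m, g m ∈ N → (∀ m', b ≠ g m') → m = ea t₀ ∨ m = eb t₀ := by
    intro m hm hbb
    obtain ⟨⟨s0, hs0⟩, hab⟩ := hN _ hm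
    rcases hab with hab | hab
    · exact (hbb m hab.symm).elim
    · obtain ⟨s, has, hbs⟩ := h.loc _ b _ t₀ hs0 hb hab
      by_cases hst : s = t₀
      · rw [← hst]; exact h.branch m s has
      · obtain ⟨m', hm'⟩ := h.disj s t₀ b hst hbs hb
        exact (hbb m' hm').elim
  have claimA : ∀ q, (∃ s, q ∈ S s) → q ∉ N → ∃ m, g m ∉ N ∧ (D q ↔ D (g m)) := by
    rintro q ⟨t, hq⟩ hqN
    by_cases hbt : b ∈ S t
    · rcases (h.seg t).alpha (hDS t) hbt hbN (fun a _ haN => (hN a haN).2) hq hqN with h1 | h1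
      · exact ⟨_, h1⟩
      · exact ⟨_, h1⟩
    · have hβ := (h.seg t).beta (hDS t) (hends t hbt) hq hqN
      by_cases h1 : g (ea t) ∈ N
      · by_cases h2 : g (eb t) ∈ N
        · exfalso
          by_cases hbb : ∃ m, b = g m
          · obtain ⟨m, rfl⟩ := hbb
            have e1 : K.Adj (g (ea t)) (g m) := by
              rcases (hN _ h1).2 with h3 | h3
              · rw [← h3] at hbt
                exact (hbt (h.seg t).left_mem).elim
              · exact h3
            have e2 : K.Adj (g (eb t)) (g m) := by
              rcases (hN _ h2).2 with h3 | h3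
              · rw [← h3] at hbt
                exact (hbt (h.seg t).right_mem).elim
              · exact h3
            have n1 := h.nonadj _ _ e1
            have n2 := h.nonadj _ _ e2
            have comb : ∀ (t : Fin 6) (m : Fin 4),
              (ea t = 0 ∧ (m = 1 ∨ m = 2)) ∨ (m = 0 ∧ (ea t = 1 ∨ ea t = 2)) →
              (eb t = 0 ∧ (m = 1 ∨ m = 2)) ∨ (m = 0 ∧ (eb t = 1 ∨ eb t = 2)) →
              m = 0 ∧ ea t = 1 := by decide
            obtain ⟨c1, c2⟩ := comb t m n1 n2
            rw [c2] at h1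
            exact hex ⟨by rw [c1], h1⟩
          · push Not at hbb
            have := e_uniq t t₀ (hnb _ h1 hbb) (hnb _ h2 hbb)
            rw [this] at hbt
            exact hbt hb
        · exact ⟨_, h2, hβ.2 h2⟩
      · exact ⟨_, h1, hβ.1 h1⟩
  have claimB0 : ∀ t, b ∉ S t → g (ea t) ∉ N → g (eb t) ∉ N → (D (g (ea t)) ↔ D (g (eb t))) := by
    intro t hbt h1 h2
    exact ((h.seg t).beta (hDS t) (hends t hbt) (h.seg t).left_mem h1).2 h2
  have claimB1 : ∀ k m, k ≠ m → (∀ t, (k = ea t ∨ k = eb t) → (m = ea t ∨ m = eb t) → b ∉ S t) →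
      g k ∉ N → g m ∉ N → (D (g k) ↔ D (g m)) := by
    intro k m hkm hb' hk hm
    obtain ⟨t, ht⟩ := e_ex k m hkm
    rcases ht with ⟨rfl, rfl⟩ | ⟨rfl, rfl⟩
    · exact claimB0 t (hb' t (Or.inl rfl) (Or.inr rfl)) hk hm
    · exact (claimB0 t (hb' t (Or.inr rfl) (Or.inl rfl)) hm hk).symm
  have claimB : ∀ k l, g k ∉ N → g l ∉ N → (D (g k) ↔ D (g l)) := by
    intro k l hk hl
    by_cases hkl : k = l
    · rw [hkl]
    by_cases hcase : ∀ t, (k = ea t ∨ k = eb t) → (l = ea t ∨ l = eb t) → b ∉ S t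
    · exact claimB1 k l hkl hcase hk hl
    · push Not at hcase
      obtain ⟨t, hkt, hlt, hbt⟩ := hcase
      have hbb : ∀ m', b ≠ g m' := by
        rintro m rfl
        have comb : ∀ (t : Fin 6) (k l m : Fin 4), k ≠ l → (k = ea t ∨ k = eb t) →
          (l = ea t ∨ l = eb t) → (m = ea t ∨ m = eb t) → m = k ∨ m = l := by decide
        rcases comb t k l m hkl hkt hlt (h.branch m t hbt) with rfl | rfl
        · exact hk hbN
        · exact hl hbN
      have ht : ∀ s, b ∈ S s → s = t := by
        intro s hs
        by_contra hst
        obtain ⟨m, hm⟩ := h.disj s t b hst hs hbt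
        exact hbb m hm
      have comb : ∀ (t : Fin 6), ∃ m, m ≠ ea t ∧ m ≠ eb t := by decide
      obtain ⟨m, hm1, hm2⟩ := comb t
      have hmt : ¬ (m = ea t ∨ m = eb t) := by tauto
      have hmN : g m ∉ N := by
        intro hmN
        have := hnb m hmN hbb
        rw [ht t₀ hb] at this
        exact hmt this
      have r1 := claimB1 k m (by rintro rfl; exact hmt hkt)
        (fun s _ h2 h3 => hmt (by rw [← ht s h3]; exact h2)) hk hmN
      have r2 := claimB1 l m (by rintro rfl; exact hmt hlt)
        (fun s _ h2 h3 => hmt (by rw [← ht s h3]; exact h2)) hl hmN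
      exact r1.trans r2.symm
  obtain ⟨m, hm, e1⟩ := claimA p hp hpN
  obtain ⟨m', hm', e2⟩ := claimA q hq hqN
  rw [e1, e2]
  exact claimB m m' hm hm'

/-- the cycle missing branch vertex m -/
def Tri (S : Fin 6 → Set W) (m : Fin 4) : Set W :=
  {a | ∃ t, a ∈ S t ∧ m ≠ ea t ∧ m ≠ eb t}

lemma K4Sys.tri_avoid (h : K4Sys K g S) {b : W} {t : Fin 6} (hb : b ∈ S t) :
    ∃ m, b ∉ Tri S m := by
  by_cases hbb : ∃ m, b = g m
  · obtain ⟨m, rfl⟩ := hbb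
    refine ⟨m, ?_⟩
    rintro ⟨s, h1, h2, h3⟩
    rcases h.branch m s h1 with h4 | h4
    · exact h2 h4
    · exact h3 h4
  · push Not at hbb
    refine ⟨ea t, ?_⟩
    rintro ⟨s, h1, h2, h3⟩
    by_cases hst : s = t
    · rw [hst] at h2; exact h2 rfl
    · obtain ⟨m, hm⟩ := h.disj s t b hst h1 hb
      exact hbb m hm

lemma K4Sys.tri_deg (h : K4Sys K g S) {m : Fin 4} {q : W} (hq : q ∈ Tri S m) :
    ∃ a ∈ Tri S m, ∃ b ∈ Tri S m, a ≠ b ∧ K.Adj q a ∧ K.Adj q b := by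
  obtain ⟨t, hqt, h1, h2⟩ := hq
  by_cases hq' : ∃ k, (k = ea t ∨ k = eb t) ∧ q = g k
  · obtain ⟨k, hk, rfl⟩ := hq'
    have comb : ∀ (t : Fin 6) (m k : Fin 4), m ≠ ea t → m ≠ eb t → (k = ea t ∨ k = eb t) →
      ∃ s, s ≠ t ∧ (k = ea s ∨ k = eb s) ∧ m ≠ ea s ∧ m ≠ eb s := by decide
    obtain ⟨s, hst, hks, h3, h4⟩ := comb t m k h1 h2 hk
    have nb : ∀ s, (k = ea s ∨ k = eb s) → ∃ a ∈ S s, K.Adj (g k) a := by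
      rintro s (rfl | rfl)
      · exact (h.seg s).nbr_left
      · exact (h.seg s).nbr_right
    obtain ⟨a, ha, hka⟩ := nb s hks
    obtain ⟨b, hb, hkb⟩ := nb t hk
    refine ⟨a, ⟨s, ha, h3, h4⟩, b, ⟨t, hb, h1, h2⟩, ?_, hka, hkb⟩
    rintro rfl
    obtain ⟨m', rfl⟩ := h.disj s t a hst ha hb
    have b1 := h.branch m' s ha
    have b2 := h.branch m' t hb
    have hne : m' ≠ k := by rintro rfl; exact hka.ne rfl
    have comb2 : ∀ (s t : Fin 6) (k m : Fin 4), (k = ea t ∨ k = eb t) → (k = ea s ∨ k = eb s) →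
      (m = ea t ∨ m = eb t) → (m = ea s ∨ m = eb s) → m ≠ k → s = t := by decide
    exact hst (comb2 s t k m' hk hks b2 b1 hne)
  · obtain ⟨a, ha, b, hb, hab, e1, e2⟩ := (h.seg t).nbr_mid hqt
      (fun h => hq' ⟨_, Or.inl rfl, h⟩) (fun h => hq' ⟨_, Or.inr rfl, h⟩)
    exact ⟨a, ⟨t, ha, h1, h2⟩, b, ⟨t, hb, h1, h2⟩, hab, e1, e2⟩

lemma K4Sys.tri_nonempty (h : K4Sys K g S) (m : Fin 4) : (Tri S m).Nonempty := by
  have comb : ∀ m : Fin 4, ∃ t, m ≠ ea t ∧ m ≠ eb t := by decide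
  obtain ⟨t, ht⟩ := comb m
  exact ⟨_, t, (h.seg t).left_mem, ht⟩

lemma K4Sys.main (h : K4Sys K g S) {A : W → W → Prop} {V : Type} (T : BurlingTree V) (φ : W → V)
    (hφ : ∀ a b, (∃ s, a ∈ S s) → (∃ s, b ∈ S s) → φ a = φ b → a = b)
    (hA : ∀ a b, (∃ s, a ∈ S s) → (∃ s, b ∈ S s) → (A a b ↔ T.Arc (φ a) (φ b)))
    (hK : ∀ a b, (∃ s, a ∈ S s) → (∃ s, b ∈ S s) → (K.Adj a b ↔ A a b ∨ A b a)) :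
    A (g 1) (g 0) := by
  by_contra hcon
  have hH : ∀ m a, a ∈ Tri S m → ∃ s, a ∈ S s := fun m a ⟨t, ht, _⟩ => ⟨t, ht⟩
  -- each triangle has a non-leaf vertex
  have nonleaf : ∀ m, ∃ b ∈ Tri S m, ∃ c ∈ Tri S m, SDesc T (φ b) (φ c) := by
    intro m
    have hex : ∃ n, ∃ s ∈ Tri S m, mu T (φ s) = n := by
      obtain ⟨s, hs⟩ := h.tri_nonempty m
      exact ⟨_, s, hs, rfl⟩
    classical
    obtain ⟨s, hs, hsn⟩ := Nat.find_spec hex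
    have hmin : ∀ a ∈ Tri S m, mu T (φ s) ≤ mu T (φ a) := by
      intro a ha
      rw [hsn]
      exact Nat.find_min' hex ⟨a, ha, rfl⟩
    obtain ⟨a, ha, b, hb, hab, e1, e2⟩ := h.tri_deg hs
    have harc : ∀ a ∈ Tri S m, K.Adj s a → T.Arc (φ s) (φ a) := by
      intro a ha hadj
      rcases (hK s a (hH m s hs) (hH m a ha)).1 hadj with h1 | h1
      · exact (hA _ _ (hH m s hs) (hH m a ha)).1 h1
      · have := arc_mu ((hA _ _ (hH m a ha) (hH m s hs)).1 h1)
        have := hmin a ha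
        omega
    rcases arc_chain (harc a ha e1) (harc b hb e2) with h1 | h1
    · exact ⟨a, ha, b, hb, h1, fun h2 => hab (hφ _ _ (hH m a ha) (hH m b hb) h2)⟩
    · exact ⟨b, hb, a, ha, h1, fun h2 => hab (hφ _ _ (hH m b hb) (hH m a ha) h2).symm⟩
  -- a non-leaf vertex is top-like
  have top : ∀ b c, (∃ s, b ∈ S s) → (∃ s, c ∈ S s) → SDesc T (φ b) (φ c) →
      ∀ q, (∃ s, q ∈ S s) → q ≠ b → SDesc T (φ b) (φ q) ∨ A q b := by
    intro b c hb hc hbc q hq hqb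
    by_cases hqA : A q b
    · exact Or.inr hqA
    left
    let N : Set W := {a | (∃ s, a ∈ S s) ∧ (a = b ∨ A a b)}
    have hstep : ∀ a c, (∃ s, a ∈ S s) → (∃ s, c ∈ S s) → a ∉ N → c ∉ N → K.Adj a c →
        SDesc T (φ b) (φ a) → SDesc T (φ b) (φ c) := by
      intro a c ha hc haN hcN hac hba
      rcases (hK a c ha hc).1 hac with h1 | h1
      · exact sep_out hba ((hA a c ha hc).1 h1)
      · rcases sep_in hba ((hA c a hc ha).1 h1) with h2 | h2
        · exact h2
        · exact (hcN ⟨hc, Or.inr ((hA c b hc hb).2 h2)⟩).elim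
    obtain ⟨t, hbt⟩ := hb
    have := h.const (N := N) (D := fun a => SDesc T (φ b) (φ a)) (p := c) (q := q) hbt
      ⟨⟨t, hbt⟩, Or.inl rfl⟩ ?_ ?_ ?_ hc hq ?_ ?_
    · exact this.1 hbc
    · rintro a ⟨ha, hab⟩
      refine ⟨ha, ?_⟩
      rcases hab with hab | hab
      · exact Or.inl hab
      · exact Or.inr ((hK a b ha ⟨t, hbt⟩).2 (Or.inl hab))
    · rintro ⟨rfl, -, h1⟩
      rcases h1 with h1 | h1
      · have := h.ginj h1
        exact absurd this (by decide)
      · exact hcon h1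
    · intro a c ha hc haN hcN hac
      exact ⟨hstep a c ha hc haN hcN hac, hstep c a hc ha hcN haN hac.symm⟩
    · rintro ⟨-, h1⟩
      rcases h1 with rfl | h1
      · exact hbc.2 rfl
      · exact (arc_incomp ((hA c b hc ⟨t, hbt⟩).1 h1)).2 hbc.1
    · rintro ⟨-, h1⟩
      rcases h1 with h1 | h1
      · exact hqb h1
      · exact hqA h1
  obtain ⟨b, hb, c, hc, hbc⟩ := nonleaf 0
  obtain ⟨t, hbt⟩ := hH _ b hb
  obtain ⟨m, hm⟩ := h.tri_avoid hbt
  obtain ⟨b', hb', c', hc', hbc'⟩ := nonleaf m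
  have hne : b' ≠ b := by rintro rfl; exact hm hb'
  have H1 := hH _ b hb
  have H2 := hH _ b' hb'
  rcases top b c H1 (hH _ c hc) hbc b' H2 hne with h1 | h1
  · rcases top b' c' H2 (hH _ c' hc') hbc' b H1 hne.symm with h2 | h2
    · exact h1.2 (h1.1.antisymm h2.1)
    · exact (arc_incomp ((hA _ _ H1 H2).1 h2)).1 h1.1
  · have a1 := (hA _ _ H2 H1).1 h1
    rcases top b' c' H2 (hH _ c' hc') hbc' b H1 hne.symm with h2 | h2
    · exact (arc_incomp a1).1 h2.1
    · have := arc_mu a1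
      have := arc_mu ((hA _ _ H1 H2).1 h2)
      omega

end Core

section Appl
variable {V : Type} {G : SimpleGraph V}

/-- branch vertices -/
def gb (c : Type4K4Core G) : Fin 4 → V := ![c.x, c.y, c.z, c.w]

/-- walks of the core -/
def qw (c : Type4K4Core G) : (t : Fin 6) → G.Walk (gb c (ea t)) (gb c (eb t))
  | 0 => c.adj_xy.toWalk
  | 1 => c.adj_xz.toWalk
  | 2 => c.Pxw
  | 3 => c.Pyz
  | 4 => c.Pyw
  | 5 => c.Pzw

lemma gb_inj (c : Type4K4Core G) : Function.Injective (gb c) := by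
  intro i j hij
  have h1 := c.ne_xy
  have h2 := c.ne_xz
  have h3 := c.ne_xw
  have h4 := c.ne_yz
  have h5 := c.ne_yw
  have h6 := c.ne_zw
  fin_cases i <;> fin_cases j <;> first | rfl | (simp [gb] at hij; grind)

/-- vertex sets of the walks -/
def sup (c : Type4K4Core G) : Fin 6 → V → Prop
  | 0 => fun a => a = c.x ∨ a = c.y
  | 1 => fun a => a = c.x ∨ a = c.z
  | 2 => fun a => a ∈ c.Pxw.support
  | 3 => fun a => a ∈ c.Pyz.support
  | 4 => fun a => a ∈ c.Pyw.support
  | 5 => fun a => a ∈ c.Pzw.support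

lemma qw_sup (c : Type4K4Core G) (t : Fin 6) (a : V) (h : a ∈ (qw c t).support) : sup c t a := by
  match t, h with
  | 0, h =>
    have h : a ∈ [c.x, c.y] := h
    simpa [sup] using h
  | 1, h =>
    have h : a ∈ [c.x, c.z] := h
    simpa [sup] using h
  | 2, h => exact h
  | 3, h => exact h
  | 4, h => exact h
  | 5, h => exact h

lemma mem_edges_of (c : Type4K4Core G) (e : Sym2 V) (h : e ∈ c.edges) :
    ∃ t, e ∈ (qw c t).edges := by
  rcases h with h | h | h | h | h | h
  · exact ⟨2, h⟩
  · exact ⟨3, h⟩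
  · exact ⟨4, h⟩
  · exact ⟨5, h⟩
  · refine ⟨0, ?_⟩
    change e ∈ [s(c.x, c.y)]
    simpa using h
  · refine ⟨1, ?_⟩
    change e ∈ [s(c.x, c.z)]
    simpa using h

lemma edges_of_mem (c : Type4K4Core G) (e : Sym2 V) (t : Fin 6) (h : e ∈ (qw c t).edges) :
    e ∈ c.edges := by
  match t, h with
  | 0, h =>
    have h : e ∈ [s(c.x, c.y)] := h
    simp [Type4K4Core.edges] at h ⊢
    tauto
  | 1, h =>
    have h : e ∈ [s(c.x, c.z)] := h
    simp [Type4K4Core.edges] at h ⊢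
    tauto
  | 2, h => exact Or.inl h
  | 3, h => exact Or.inr (Or.inl h)
  | 4, h => exact Or.inr (Or.inr (Or.inl h))
  | 5, h => exact Or.inr (Or.inr (Or.inr (Or.inl h)))

lemma qw_branch (c : Type4K4Core G) (m : Fin 4) (t : Fin 6) (h : gb c m ∈ (qw c t).support) :
    m = ea t ∨ m = eb t := by
  have h1 := c.ne_xy
  have h2 := c.ne_xz
  have h3 := c.ne_xw
  have h4 := c.ne_yz
  have h5 := c.ne_yw
  have h6 := c.ne_zw
  have d1 := c.d₁
  have d2 := c.d₂
  have d3 := c.d₃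
  have d4 := c.d₄
  have d5 := c.d₅
  have d6 := c.d₆
  have a1 := c.Pxw.start_mem_support
  have a2 := c.Pxw.end_mem_support
  have a3 := c.Pyz.start_mem_support
  have a4 := c.Pyz.end_mem_support
  have a5 := c.Pyw.start_mem_support
  have a6 := c.Pyw.end_mem_support
  have a7 := c.Pzw.start_mem_support
  have a8 := c.Pzw.end_mem_support
  have h := qw_sup c t _ h
  fin_cases m <;> fin_cases t <;>
    first
    | (left; rfl)
    | (right; rfl)
    | (exfalso; simp [gb, sup] at h; grind)

lemma qw_disj (c : Type4K4Core G) (s t : Fin 6) (a : V) (hst : s ≠ t) (h : a ∈ (qw c s).support)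
    (h' : a ∈ (qw c t).support) : ∃ m, a = gb c m := by
  have key : a = c.x ∨ a = c.y ∨ a = c.z ∨ a = c.w := by
    have d1 := c.d₁ a
    have d2 := c.d₂ a
    have d3 := c.d₃ a
    have d4 := c.d₄ a
    have d5 := c.d₅ a
    have d6 := c.d₆ a
    have h := qw_sup c s _ h
    have h' := qw_sup c t _ h'
    fin_cases s <;> fin_cases t <;>
      first
      | (exact (hst rfl).elim)
      | (simp [sup] at h h'; grind)
  rcases key with h | h | h | h
  · exact ⟨0, h⟩
  · exact ⟨1, h⟩
  · exact ⟨2, h⟩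
  · exact ⟨3, h⟩

/-- a path of length at least two does not use an edge joining its ends -/
lemma path_no_end_edge {a b : V} (p : G.Walk a b) (hp : p.IsPath) (hl : 2 ≤ p.length) :
    s(a, b) ∉ p.edges := by
  intro h
  cases p with
  | nil => simp at hl
  | cons hadj q =>
    rename_i d
    rw [SimpleGraph.Walk.cons_isPath_iff] at hp
    rw [SimpleGraph.Walk.edges_cons, List.mem_cons] at h
    rcases h with h | h
    · have hbd : b = d := by
        rw [Sym2.eq_iff] at h
        rcases h with h | h
        · exact h.2
        · exact h.2.trans h.1
      subst hbd
      have := (SimpleGraph.Walk.isPath_iff_nil.1 hp.1).eq_nil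
      rw [this] at hl
      simp at hl
    · exact hp.2 (SimpleGraph.Walk.fst_mem_support_of_mem_edges q h)

lemma gb_nonadj (c : Type4K4Core G) (k l : Fin 4) (h : s(gb c k, gb c l) ∈ c.edges) (hkl : k ≠ l) :
    (k = 0 ∧ (l = 1 ∨ l = 2)) ∨ (l = 0 ∧ (k = 1 ∨ k = 2)) := by
  obtain ⟨t, ht⟩ := mem_edges_of c _ h
  have h1 := qw_branch c k t (SimpleGraph.Walk.fst_mem_support_of_mem_edges _ ht)
  have h2 := qw_branch c l t (SimpleGraph.Walk.snd_mem_support_of_mem_edges _ ht)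
  have ht' : s(gb c (ea t), gb c (eb t)) ∈ (qw c t).edges := by
    rcases h1 with rfl | rfl <;> rcases h2 with rfl | rfl
    · exact (hkl rfl).elim
    · exact ht
    · rw [Sym2.eq_swap]; exact ht
    · exact (hkl rfl).elim
  have h01 : t = 0 ∨ t = 1 := by
    match t, ht' with
    | 0, _ => exact Or.inl rfl
    | 1, _ => exact Or.inr rfl
    | 2, h => exact (path_no_end_edge c.Pxw c.Pxw_path c.Pxw_len h).elim
    | 3, h => exact (path_no_end_edge c.Pyz c.Pyz_path c.Pyz_len h).elim
    | 4, h => exact (path_no_end_edge c.Pyw c.Pyw_path c.Pyw_len h).elim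
    | 5, h => exact (path_no_end_edge c.Pzw c.Pzw_path c.Pzw_len h).elim
  have comb : ∀ (t : Fin 6) (k l : Fin 4), k ≠ l → (k = ea t ∨ k = eb t) → (l = ea t ∨ l = eb t) →
    (t = 0 ∨ t = 1) → (k = 0 ∧ (l = 1 ∨ l = 2)) ∨ (l = 0 ∧ (k = 1 ∨ k = 2)) := by decide
  exact comb t k l hkl h1 h2 h01

end Appl

section Final
variable {V W : Type} {G : SimpleGraph V} {G' : SimpleGraph W} {f : V ↪ W}
  {P : ∀ ⦃u v : V⦄, G.Adj u v → G'.Walk (f u) (f v)}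

lemma reach_bundle {B : Set W} {u v : V} (Q : G.Walk u v) (hu : f u ∈ B)
    (hB : ∀ p q (h : G.Adj p q), s(p, q) ∈ Q.edges → ∀ a ∈ (P h).support, a ∈ B) :
    ∃ hv : f v ∈ B, (G'.induce B).Reachable ⟨f u, hu⟩ ⟨f v, hv⟩ := by
  induction Q with
  | nil => exact ⟨hu, SimpleGraph.Reachable.refl _⟩
  | cons hadj q ih =>
    have h1 := hB _ _ hadj (by simp)
    have hd := h1 _ (P hadj).end_mem_support
    obtain ⟨hv, hr⟩ := ih hd (fun p q h hm => hB p q h (by simp [hm]))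
    exact ⟨hv, SimpleGraph.Reachable.trans ⟨(P hadj).induce B h1⟩ hr⟩

/-- bundle in the subdivision -/
def bun (P : ∀ ⦃u v : V⦄, G.Adj u v → G'.Walk (f u) (f v)) (c : Type4K4Core G) (t : Fin 6) : Set W :=
  {a | ∃ u v, ∃ h : G.Adj u v, s(u, v) ∈ (qw c t).edges ∧ a ∈ (P h).support}

lemma bun_branch (hP : IsSubdivisionVia G' G f P) (c : Type4K4Core G) {t : Fin 6} {v : V}
    (h : f v ∈ bun P c t) : v ∈ (qw c t).support := by
  obtain ⟨u, w, h1, h2, h3⟩ := h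
  rcases hP.2.1 h1 v h3 with rfl | rfl
  · exact SimpleGraph.Walk.fst_mem_support_of_mem_edges _ h2
  · exact SimpleGraph.Walk.snd_mem_support_of_mem_edges _ h2

lemma es_disj (c : Type4K4Core G) {s t : Fin 6} {u v : V} (hst : s ≠ t) (huv : u ≠ v)
    (h1 : s(u, v) ∈ (qw c s).edges) (h2 : s(u, v) ∈ (qw c t).edges) : False := by
  have a1 := SimpleGraph.Walk.fst_mem_support_of_mem_edges _ h1
  have a2 := SimpleGraph.Walk.snd_mem_support_of_mem_edges _ h1
  have b1 := SimpleGraph.Walk.fst_mem_support_of_mem_edges _ h2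
  have b2 := SimpleGraph.Walk.snd_mem_support_of_mem_edges _ h2
  obtain ⟨m, rfl⟩ := qw_disj c s t u hst a1 b1
  obtain ⟨m', rfl⟩ := qw_disj c s t v hst a2 b2
  have comb2 : ∀ (s t : Fin 6) (k m : Fin 4), (k = ea t ∨ k = eb t) → (k = ea s ∨ k = eb s) →
      (m = ea t ∨ m = eb t) → (m = ea s ∨ m = eb s) → m ≠ k → s = t := by decide
  refine hst (comb2 s t m m' (qw_branch c _ _ b1) (qw_branch c _ _ a1) (qw_branch c _ _ b2)
    (qw_branch c _ _ a2) ?_)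
  rintro rfl
  exact huv rfl

lemma bun_disj (hP : IsSubdivisionVia G' G f P) (c : Type4K4Core G) {s t : Fin 6} {a : W}
    (hst : s ≠ t) (h1 : a ∈ bun P c s) (h2 : a ∈ bun P c t) : ∃ m, a = f (gb c m) := by
  have h1' := h1
  have h2' := h2
  obtain ⟨u, v, e1, m1, a1⟩ := h1
  obtain ⟨u', v', e2, m2, a2⟩ := h2
  have hne : s(u, v) ≠ s(u', v') := by
    intro h
    rw [← h] at m2
    exact es_disj c hst e1.ne m1 m2
  obtain ⟨x, rfl⟩ := hP.2.2.1 e1 e2 hne a a1 a2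
  obtain ⟨m, rfl⟩ := qw_disj c s t x hst (bun_branch hP c h1') (bun_branch hP c h2')
  exact ⟨m, rfl⟩

lemma sup_supp (c : Type4K4Core G) {t : Fin 6} {a : V} (h : sup c t a) : a ∈ c.supp := by
  match t, h with
  | 0, h =>
    rcases h with rfl | rfl
    · exact Or.inl c.Pxw.start_mem_support
    · exact Or.inr (Or.inl c.Pyz.start_mem_support)
  | 1, h =>
    rcases h with rfl | rfl
    · exact Or.inl c.Pxw.start_mem_support
    · exact Or.inr (Or.inl c.Pyz.end_mem_support)
  | 2, h => exact Or.inl h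
  | 3, h => exact Or.inr (Or.inl h)
  | 4, h => exact Or.inr (Or.inr (Or.inl h))
  | 5, h => exact Or.inr (Or.inr (Or.inr h))

lemma edges_supp (c : Type4K4Core G) {u v : V} (h : s(u, v) ∈ c.edges) :
    u ∈ c.supp ∧ v ∈ c.supp := by
  obtain ⟨t, ht⟩ := mem_edges_of c _ h
  exact ⟨sup_supp c (qw_sup c t _ (SimpleGraph.Walk.fst_mem_support_of_mem_edges _ ht)),
    sup_supp c (qw_sup c t _ (SimpleGraph.Walk.snd_mem_support_of_mem_edges _ ht))⟩

lemma gb_supp (c : Type4K4Core G) (m : Fin 4) : gb c m ∈ c.supp := by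
  have comb : ∀ m : Fin 4, ∃ t, m = ea t ∨ m = eb t := by decide
  obtain ⟨t, rfl | rfl⟩ := comb m
  · exact sup_supp c (qw_sup c t _ (qw c t).start_mem_support)
  · exact sup_supp c (qw_sup c t _ (qw c t).end_mem_support)

lemma exists_sys (hP : IsSubdivisionVia G' G f P) (c : Type4K4Core G)
    (hind : ∀ p q, G.Adj p q → p ∈ c.supp → q ∈ c.supp → s(p, q) ∈ c.edges) :
    ∃ S : Fin 6 → Set W, (∀ t, S t ⊆ bun P c t) ∧ K4Sys G' (fun m => f (gb c m)) S := by
  have hne : ∀ t, f (gb c (ea t)) ≠ f (gb c (eb t)) := fun t h =>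
    e_ne t (gb_inj c (f.injective h))
  have hstart : ∀ t, f (gb c (ea t)) ∈ bun P c t := by
    intro t
    have hq : ¬ (qw c t).Nil := fun h => hne t (congrArg f h.eq)
    have hmem := SimpleGraph.Walk.adj_snd hq
    refine ⟨_, _, hmem, ?_, (P hmem).start_mem_support⟩
    exact SimpleGraph.Walk.mk_start_snd_mem_edges hq
  have hex : ∀ t, ∃ S ⊆ bun P c t, Seg G' S (f (gb c (ea t))) (f (gb c (eb t))) := by
    intro t
    obtain ⟨hv, hr⟩ := reach_bundle (P := P) (B := bun P c t) (qw c t) (hstart t)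
      (fun p q h hm a ha => ⟨p, q, h, hm, ha⟩)
    exact exists_seg (hstart t) hv (hne t) hr
  choose S hS hseg using hex
  have hbr : ∀ m t, f (gb c m) ∈ bun P c t → m = ea t ∨ m = eb t := fun m t h =>
    qw_branch c m t (bun_branch hP c h)
  -- any edge of the subdivision between vertices of bundles comes from an edge of the core
  have hedge : ∀ a b s s', a ∈ bun P c s → b ∈ bun P c s' → G'.Adj a b →
      ∃ u v, ∃ h : G.Adj u v, s(u, v) ∈ c.edges ∧ a ∈ (P h).support ∧ b ∈ (P h).support := by
    intro a b s s' ha hb hab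
    obtain ⟨u, v, h, he⟩ := hP.2.2.2.2 hab
    have ha1 := SimpleGraph.Walk.fst_mem_support_of_mem_edges _ he
    have hb1 := SimpleGraph.Walk.snd_mem_support_of_mem_edges _ he
    refine ⟨u, v, h, ?_, ha1, hb1⟩
    by_contra hcon
    have aux : ∀ a s, a ∈ bun P c s → a ∈ (P h).support →
        ∃ x, a = f x ∧ x ∈ c.supp ∧ (x = u ∨ x = v) := by
      intro a s has ha1
      have has' := has
      obtain ⟨u', v', e', m', a'⟩ := has
      have hne : s(u', v') ≠ s(u, v) := by
        intro hh
        rw [hh] at m'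
        exact hcon (edges_of_mem c _ _ m')
      obtain ⟨x, rfl⟩ := hP.2.2.1 e' h hne a a' ha1
      exact ⟨x, rfl, sup_supp c (qw_sup c s _ (bun_branch hP c has')), hP.2.1 h x ha1⟩
    obtain ⟨x, rfl, hx, hx'⟩ := aux a s ha ha1
    obtain ⟨y, rfl, hy, hy'⟩ := aux b s' hb hb1
    have hxy : x ≠ y := by rintro rfl; exact hab.ne rfl
    apply hcon
    rcases hx' with rfl | rfl <;> rcases hy' with rfl | rfl
    · exact (hxy rfl).elim
    · exact hind _ _ h hx hy
    · exact hind _ _ h hy hx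
    · exact (hxy rfl).elim
  have hend : ∀ m t, (m = ea t ∨ m = eb t) → f (gb c m) ∈ S t := by
    rintro m t (rfl | rfl)
    · exact (hseg t).left_mem
    · exact (hseg t).right_mem
  refine ⟨S, hS, ?_, hseg, ?_, ?_, ?_, ?_⟩
  · intro i j hij
    exact gb_inj c (f.injective hij)
  · intro m t h
    exact hbr m t (hS t h)
  · intro s t a hst h1 h2
    exact bun_disj hP c hst (hS s h1) (hS t h2)
  · intro a b s s' ha hb hab
    obtain ⟨u, v, h, he, h1, h2⟩ := hedge a b s s' (hS s ha) (hS s' hb) hab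
    obtain ⟨t, ht⟩ := mem_edges_of c _ he
    have aux : ∀ a s, a ∈ S s → a ∈ (P h).support → a ∈ S t := by
      intro a s has hah
      by_cases hst : s = t
      · rw [← hst]; exact has
      · have hat : a ∈ bun P c t := ⟨u, v, h, ht, hah⟩
        obtain ⟨m, rfl⟩ := bun_disj hP c hst (hS s has) hat
        exact hend m t (hbr m t hat)
    exact ⟨t, aux a s ha h1, aux b s' hb h2⟩
  · intro k l hkl
    have hkl' : k ≠ l := by rintro rfl; exact hkl.ne rfl
    apply gb_nonadj c k l _ hkl'
    have comb : ∀ m : Fin 4, ∃ t, m = ea t ∨ m = eb t := by decide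
    obtain ⟨s, hs⟩ := comb k
    obtain ⟨s', hs'⟩ := comb l
    obtain ⟨u, v, h, he, h1, h2⟩ := hedge _ _ s s' (hS _ (hend k s hs)) (hS _ (hend l s' hs')) hkl
    have hne' : gb c k ≠ gb c l := fun h => hkl' (gb_inj c h)
    rcases hP.2.1 h _ h1 with e1 | e1 <;> rcases hP.2.1 h _ h2 with e2 | e2
    · exact (hne' (e1.trans e2.symm)).elim
    · rw [e1, e2]; exact he
    · rw [e1, e2, Sym2.eq_swap]; exact he
    · exact (hne' (e1.trans e2.symm)).elim

lemma side (hP : IsSubdivisionVia G' G f P) (c : Type4K4Core G)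
    (hind : ∀ p q, G.Adj p q → p ∈ c.supp → q ∈ c.supp → s(p, q) ∈ c.edges)
    {A : W → W → Prop} (hA : IsOrientation G' A)
    (hB : IsOrientedBurling
              (G'.induce {w : W | ∃ p q, ∃ h : G.Adj p q, s(p, q) ∈ c.edges ∧
                w ∈ (P h).support})
              (fun p q => A p.1 q.1)) : A (f c.y) (f c.x) := by
  classical
  obtain ⟨S, hS, hsys⟩ := exists_sys hP c hind
  obtain ⟨X, hX⟩ : ∃ X : Set W, X = {w : W | ∃ p q, ∃ h : G.Adj p q, s(p, q) ∈ c.edges ∧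
      w ∈ (P h).support} := ⟨_, rfl⟩
  rw [← hX] at hB
  obtain ⟨-, U, T, φ, hφ⟩ := hB
  have hSX : ∀ a, (∃ s, a ∈ S s) → a ∈ X := by
    rintro a ⟨s, hs⟩
    obtain ⟨u, v, h, he, h1⟩ := hS s hs
    rw [hX]
    exact ⟨u, v, h, edges_of_mem c _ _ he, h1⟩
  refine hsys.main T (fun w => if h : w ∈ X then φ ⟨w, h⟩ else T.root) ?_ ?_ ?_
  · intro a b ha hb hab
    have ha := hSX a ha
    have hb := hSX b hb
    simp only [ha, hb, dif_pos] at hab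
    exact congrArg Subtype.val (φ.injective hab)
  · intro a b ha hb
    have ha := hSX a ha
    have hb := hSX b hb
    simp only [ha, hb, dif_pos]
    exact hφ ⟨a, ha⟩ ⟨b, hb⟩
  · intro a b _ _
    constructor
    · intro h
      have := hA.2 a b h
      tauto
    · rintro (h | h)
      · exact hA.1 _ _ h
      · exact (hA.1 _ _ h).symm

lemma burling_induce {A : W → W → Prop} (h : IsOrientedBurling G' A) (X : Set W) :
    IsOrientedBurling (G'.induce X) (fun p q => A p.1 q.1) := by
  obtain ⟨hA, U, T, φ, hφ⟩ := h
  refine ⟨⟨fun u v h => hA.1 _ _ h, fun u v h => hA.2 _ _ h⟩, U, T,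
    (Function.Embedding.subtype _).trans φ, fun u v => hφ _ _⟩

end Final

/-- gluing two Burling-admissible type-4 subdivisions of `K₄` along the common
edge `xy` (forced centers `y` resp. `x`) yields a graph no subdivision of which admits an
orientation making both copies oriented Burling graphs; hence no subdivision of it is a
Burling graph. -/
theorem glued_type4K4_no_Burling_subdivision (V : Type) (G : SimpleGraph V)
    (c₁ c₂ : Type4K4Core G) (hx : c₁.x = c₂.y) (hy : c₁.y = c₂.x)
    (hshared : ∀ v, v ∈ c₁.supp → v ∈ c₂.supp → v = c₁.x ∨ v = c₁.y)
    (hcovV : ∀ v : V, v ∈ c₁.supp ∨ v ∈ c₂.supp)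
    (hcovE : ∀ p q, G.Adj p q → s(p, q) ∈ c₁.edges ∨ s(p, q) ∈ c₂.edges) :
    (∀ (W : Type) (G' : SimpleGraph W) (f : V ↪ W)
      (P : ∀ ⦃p q : V⦄, G.Adj p q → G'.Walk (f p) (f q)), IsSubdivisionVia G' G f P →
      ∀ A : W → W → Prop, IsOrientation G' A →
        ¬ (IsOrientedBurling
              (G'.induce {w : W | ∃ p q, ∃ h : G.Adj p q, s(p, q) ∈ c₁.edges ∧
                w ∈ (P h).support})
              (fun p q => A p.1 q.1) ∧
           IsOrientedBurling
              (G'.induce {w : W | ∃ p q, ∃ h : G.Adj p q, s(p, q) ∈ c₂.edges ∧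
                w ∈ (P h).support})
              (fun p q => A p.1 q.1))) ∧
    ∀ (W : Type) (G' : SimpleGraph W), IsSubdivision G' G → ¬ IsBurlingGraph G' := by
  have hind₁ : ∀ p q, G.Adj p q → p ∈ c₁.supp → q ∈ c₁.supp → s(p, q) ∈ c₁.edges := by
    intro p q h hp hq
    rcases hcovE p q h with he | he
    · exact he
    · obtain ⟨hp2, hq2⟩ := edges_supp c₂ he
      right; right; right; right; left
      rcases hshared p hp hp2 with rfl | rfl <;> rcases hshared q hq hq2 with rfl | rfl
      · exact (h.ne rfl).elim
      · rfl
      · exact Sym2.eq_swap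
      · exact (h.ne rfl).elim
  have hind₂ : ∀ p q, G.Adj p q → p ∈ c₂.supp → q ∈ c₂.supp → s(p, q) ∈ c₂.edges := by
    intro p q h hp hq
    rcases hcovE p q h with he | he
    · obtain ⟨hp2, hq2⟩ := edges_supp c₁ he
      right; right; right; right; left
      rw [← hx, ← hy]
      rcases hshared p hp2 hp with rfl | rfl <;> rcases hshared q hq2 hq with rfl | rfl
      · exact (h.ne rfl).elim
      · exact Sym2.eq_swap
      · rfl
      · exact (h.ne rfl).elim
    · exact he
  have part1 : ∀ (W : Type) (G' : SimpleGraph W) (f : V ↪ W)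
      (P : ∀ ⦃p q : V⦄, G.Adj p q → G'.Walk (f p) (f q)), IsSubdivisionVia G' G f P →
      ∀ A : W → W → Prop, IsOrientation G' A →
        ¬ (IsOrientedBurling
              (G'.induce {w : W | ∃ p q, ∃ h : G.Adj p q, s(p, q) ∈ c₁.edges ∧
                w ∈ (P h).support})
              (fun p q => A p.1 q.1) ∧
           IsOrientedBurling
              (G'.induce {w : W | ∃ p q, ∃ h : G.Adj p q, s(p, q) ∈ c₂.edges ∧
                w ∈ (P h).support})
              (fun p q => A p.1 q.1)) := by
    rintro W G' f P hP A hA ⟨h1, h2⟩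
    have r1 := side hP c₁ hind₁ hA h1
    have r2 := side hP c₂ hind₂ hA h2
    rw [← hx, ← hy] at r2
    exact (hA.2 _ _ (hA.1 _ _ r1)).1 r1 r2
  refine ⟨part1, ?_⟩
  rintro W G' ⟨f, P, hP⟩ ⟨A, hA⟩
  exact part1 W G' f P hP A hA.1 ⟨burling_induce hA _, burling_induce hA _⟩

end BurlingFormal
end
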